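/- arXiv:2503.08488 — 5 statements merged into one kernel-verified Lean document; each statement's English description precedes it below -/
import Mathlib

section
/- For every fixed L ≥ 2 and all x, y ∈ Λ_L°, the free-boundary two-point function is nondecreasing in the inverse temperature: if 0 < β ≤ β′ then ⟨cos(θ_x − θ_y)⟩_{L,0,β} ≤ ⟨cos(θ_x − θ_y)⟩_{L,0,β′}. -/
open MeasureTheory Real Filter

noncomputable section

abbrev Site : Type := Fin 3 → ℤ

/-- Nearest-neighbor adjacency on `ℤ³`. -/
def adj (k l : Site) : Prop := (∑ i, |k i - l i|) = 1

instance (k l : Site) : Decidable (adj k l) := by unfold adj; infer_instance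

/-- The interior `Λ_L° = ((-L,L) ∩ ℤ)³`. -/
def interF (L : ℕ) : Finset Site := Finset.Icc (fun _ => -(L : ℤ) + 1) (fun _ => (L : ℤ) - 1)

/-- The box `Λ_L = ([-L,L] ∩ ℤ)³`. -/
def lamF (L : ℕ) : Finset Site := Finset.Icc (fun _ => -(L : ℤ)) (fun _ => (L : ℤ))

/-- Configurations of angles on the interior of `Λ_L`. -/
abbrev Cfg (L : ℕ) : Type := ↥(interF L) → ℝ

/-- The cube `[0,2π]^{Λ_L°}`. -/
def cube (L : ℕ) : Set (Cfg L) := Set.univ.pi fun _ => Set.Icc 0 (2 * π)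

/-- Evaluation of a configuration at a site (`0` outside the interior). -/
def val (L : ℕ) (θ : Cfg L) (x : Site) : ℝ := if h : x ∈ interF L then θ ⟨x, h⟩ else 0

/-- Free-boundary energy `(β/6) Σ_{k,l ∈ Λ_L°, |k-l|=1} cos(θ_k - θ_l)`. -/
def energy0 (L : ℕ) (β : ℝ) (θ : Cfg L) : ℝ :=
  β / 6 * ∑ k : ↥(interF L), ∑ l : ↥(interF L),
    if adj k.1 l.1 then Real.cos (θ k - θ l) else 0

/-- `N_∂(k)`, the number of boundary neighbors of `k`. -/
def nBd (L : ℕ) (k : Site) : ℕ := ((lamF L \ interF L).filter fun l => adj k l).card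

/-- Plus-boundary energy. -/
def energyP (L : ℕ) (β : ℝ) (θ : Cfg L) : ℝ :=
  energy0 L β θ + β / 3 * ∑ k : ↥(interF L), (nBd L k.1 : ℝ) * Real.cos (θ k)

/-- Free-boundary expectation `⟨F⟩_{L,0,β}`. -/
def avg0 (L : ℕ) (β : ℝ) (F : Cfg L → ℝ) : ℝ :=
  (∫ θ in cube L, F θ * Real.exp (energy0 L β θ)) / ∫ θ in cube L, Real.exp (energy0 L β θ)

/-- Plus-boundary expectation `⟨F⟩_{L,+,β}`. -/
def avgP (L : ℕ) (β : ℝ) (F : Cfg L → ℝ) : ℝ :=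
  (∫ θ in cube L, F θ * Real.exp (energyP L β θ)) / ∫ θ in cube L, Real.exp (energyP L β θ)

/-- Free-boundary two-point function `⟨cos(θ_x - θ_y)⟩_{L,0,β}`. -/
def corr0 (L : ℕ) (β : ℝ) (x y : Site) : ℝ :=
  avg0 L β fun θ => Real.cos (val L θ x - val L θ y)

/-- Plus-boundary two-point function `⟨cos(θ_x - θ_y)⟩_{L,+,β}`. -/
def corrPlus (L : ℕ) (β : ℝ) (x y : Site) : ℝ :=
  avgP L β fun θ => Real.cos (val L θ x - val L θ y)

/-- Finite-volume plus-boundary magnetization at site `y`. -/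
def magAt (L : ℕ) (β : ℝ) (y : Site) : ℝ := avgP L β fun θ => Real.cos (val L θ y)

/-- The spontaneous magnetization `m*(β) = inf_{L ≥ 2} ⟨cos θ_0⟩_{L,+,β}`. -/
def mStar (β : ℝ) : ℝ := sInf {r : ℝ | ∃ L : ℕ, 2 ≤ L ∧ r = magAt L β 0}

/-- The critical inverse temperature `β_c`. -/
def critBeta : ℝ := sSup {β : ℝ | 0 < β ∧ mStar β = 0}

/-- Sup-norm on `ℤ³`. -/
def supNorm (x : Site) : ℤ := max |x 0| (max |x 1| |x 2|)

/-- Infinite-volume free-boundary two-point function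
`⟨S_x·S_y⟩_{0,β} = sup_{L > max(‖x‖∞,‖y‖∞)} ⟨cos(θ_x - θ_y)⟩_{L,0,β}`. -/
def S20 (β : ℝ) (x y : Site) : ℝ :=
  sSup {r : ℝ | ∃ L : ℕ, max (supNorm x) (supNorm y) < (L : ℤ) ∧ r = corr0 L β x y}

/-- The box `B_n = {z ∈ ℤ³ : max |z_i| ≤ n}`. -/
def Bn (n : ℕ) : Finset Site := Finset.Icc (fun _ => -(n : ℤ)) (fun _ => (n : ℤ))

/-- Fundamental domain `{-L,…,L-1}³` for the torus `T_L = (ℤ/2Lℤ)³`. -/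
def torF (L : ℕ) : Finset Site := Finset.Icc (fun _ => -(L : ℤ)) (fun _ => (L : ℤ) - 1)

/-- Distance on `ℤ/2Lℤ`. -/
def torDist (L : ℕ) (m : ℤ) : ℤ := min (m % (2 * (L : ℤ))) (2 * (L : ℤ) - m % (2 * (L : ℤ)))

/-- Graph adjacency on the torus `T_L`. -/
def adjT (L : ℕ) (k l : Site) : Prop := (∑ i, torDist L (k i - l i)) = 1

instance (L : ℕ) (k l : Site) : Decidable (adjT L k l) := by unfold adjT; infer_instance

abbrev TCfg (L : ℕ) : Type := ↥(torF L) → ℝ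

def cubeT (L : ℕ) : Set (TCfg L) := Set.univ.pi fun _ => Set.Icc 0 (2 * π)

def valT (L : ℕ) (θ : TCfg L) (x : Site) : ℝ := if h : x ∈ torF L then θ ⟨x, h⟩ else 0

/-- Periodic-boundary energy on the torus `T_L`. -/
def energyT (L : ℕ) (β : ℝ) (θ : TCfg L) : ℝ :=
  β / 6 * ∑ k : ↥(torF L), ∑ l : ↥(torF L),
    if adjT L k.1 l.1 then Real.cos (θ k - θ l) else 0

/-- Periodic-boundary expectation `⟨F⟩_{L,P,β}`. -/
def avgT (L : ℕ) (β : ℝ) (F : TCfg L → ℝ) : ℝ :=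
  (∫ θ in cubeT L, F θ * Real.exp (energyT L β θ)) / ∫ θ in cubeT L, Real.exp (energyT L β θ)

/-- Periodic two-point function `⟨cos(θ_x - θ_y)⟩_{L,P,β}`. -/
def corrT (L : ℕ) (β : ℝ) (x y : Site) : ℝ :=
  avgT L β fun θ => Real.cos (valT L θ x - valT L θ y)

/-- `Ĵ(k) = (cos k₁ + cos k₂ + cos k₃)/3`. -/
def Jhat (k : Fin 3 → ℝ) : ℝ := (Real.cos (k 0) + Real.cos (k 1) + Real.cos (k 2)) / 3

/-- The cube `[-π,π]³`. -/
def Qpi : Set (Fin 3 → ℝ) := Set.univ.pi fun _ => Set.Icc (-π) π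

/-- The lattice Green-type function `G(v)`. -/
def green (v : Site) : ℝ :=
  ((2 * π) ^ 3)⁻¹ * ∫ k in Qpi, Real.cos (∑ i, k i * (v i : ℝ)) / (1 - Jhat k)

/-- `G(x,y) := G(x-y)`. -/
def greenXY (x y : Site) : ℝ := green (x - y)

end

/-- The kernel `s(u) s(v) (∑ i, a i * g i u * g i v) ^ n` has nonnegative integral. -/
theorem integral_kernel_pow_nonneg {X ι : Type*} [Fintype ι] [TopologicalSpace X] [CompactSpace X]
    [SecondCountableTopology X] [MeasurableSpace X] [BorelSpace X] (μ : Measure X)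
    [IsFiniteMeasure μ] (a : ι → ℝ) (ha : ∀ i, 0 ≤ a i) (g : ι → X → ℝ)
    (hg : ∀ i, Continuous (g i)) (n : ℕ) (s : X → ℝ) (hs : Continuous s) :
    0 ≤ ∫ p, s p.1 * s p.2 * (∑ i, a i * (g i p.1 * g i p.2)) ^ n ∂μ.prod μ := by
  induction n generalizing s with
  | zero =>
    simp only [pow_zero, mul_one]
    rw [integral_prod_mul]
    exact mul_self_nonneg _
  | succ n ih =>
    have h (p : X × X) : s p.1 * s p.2 * (∑ i, a i * (g i p.1 * g i p.2)) ^ (n + 1) =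
        ∑ i, a i * ((s p.1 * g i p.1) * (s p.2 * g i p.2) *
          (∑ i, a i * (g i p.1 * g i p.2)) ^ n) := by
      rw [pow_succ', ← mul_assoc, Finset.mul_sum, Finset.sum_mul]
      exact Finset.sum_congr rfl fun i _ => by ring
    simp only [h]
    rw [integral_finsetSum]
    · refine Finset.sum_nonneg fun i _ => ?_
      rw [integral_const_mul]
      exact mul_nonneg (ha i) (ih (fun x => s x * g i x) (hs.mul (hg i)))
    · intro i _
      refine Continuous.integrable_of_hasCompactSupport (by fun_prop) ?_
      exact HasCompactSupport.of_compactSpace _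

/-- The kernel `s(u) s(v) exp (∑ i, a i * g i u * g i v)` has nonnegative integral. -/
theorem integral_kernel_exp_nonneg {X ι : Type*} [Fintype ι] [TopologicalSpace X] [CompactSpace X]
    [SecondCountableTopology X] [MeasurableSpace X] [BorelSpace X] (μ : Measure X)
    [IsFiniteMeasure μ] (a : ι → ℝ) (ha : ∀ i, 0 ≤ a i) (g : ι → X → ℝ)
    (hg : ∀ i, Continuous (g i)) (s : X → ℝ) (hs : Continuous s) :
    0 ≤ ∫ p, s p.1 * s p.2 * Real.exp (∑ i, a i * (g i p.1 * g i p.2)) ∂μ.prod μ := by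
  have hS : Continuous fun p : X × X => ∑ i, a i * (g i p.1 * g i p.2) := by fun_prop
  have hT : Continuous fun p : X × X => s p.1 * s p.2 := by fun_prop
  obtain ⟨B, hB⟩ := isCompact_univ.exists_bound_of_continuousOn hS.continuousOn
  obtain ⟨M, hM⟩ := isCompact_univ.exists_bound_of_continuousOn hT.continuousOn
  have key := hasSum_integral_of_dominated_convergence (μ := μ.prod μ)
    (F := fun (n : ℕ) (p : X × X) =>
      s p.1 * s p.2 * ((∑ i, a i * (g i p.1 * g i p.2)) ^ n / n.factorial))
    (f := fun p => s p.1 * s p.2 * Real.exp (∑ i, a i * (g i p.1 * g i p.2)))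
    (fun n _ => M * (B ^ n / n.factorial))
    (fun n => Continuous.aestronglyMeasurable (by fun_prop))
    (fun n => .of_forall fun p => by
      rw [norm_mul, norm_div, norm_pow, RCLike.norm_natCast]
      have h := hM p (Set.mem_univ _)
      have := (norm_nonneg _).trans h
      gcongr
      exact hB p (Set.mem_univ _))
    (.of_forall fun p => (Real.summable_pow_div_factorial B).mul_left M)
    (integrable_const _)
    (.of_forall fun p => by
      simp only [Real.exp_eq_exp_ℝ]
      exact (NormedSpace.expSeries_div_hasSum_exp (𝔸 := ℝ) _).mul_left _)
  refine key.nonneg fun n => ?_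
  simp only [← mul_div_assoc, integral_div]
  exact div_nonneg (integral_kernel_pow_nonneg μ a ha g hg n s hs) (by positivity)

instance fact_two_pi_pos : Fact (0 < 2 * π) := ⟨Real.two_pi_pos⟩

/-- Cosine as a function on the circle `ℝ / 2πℤ`. -/
noncomputable def circleCos (a : AddCircle (2 * π)) : ℝ := Real.Angle.cos a

/-- Sine as a function on the circle `ℝ / 2πℤ`. -/
noncomputable def circleSin (a : AddCircle (2 * π)) : ℝ := Real.Angle.sin a

@[fun_prop]
theorem continuous_circleCos : Continuous circleCos := Real.Angle.continuous_cos

@[fun_prop]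
theorem continuous_circleSin : Continuous circleSin := Real.Angle.continuous_sin

theorem circleCos_coe (x : ℝ) : circleCos (x : AddCircle (2 * π)) = Real.cos x := rfl

theorem circleCos_add (a b : AddCircle (2 * π)) :
    circleCos (a + b) = circleCos a * circleCos b - circleSin a * circleSin b :=
  Real.Angle.cos_add a b

theorem circleCos_sub (a b : AddCircle (2 * π)) :
    circleCos (a - b) = circleCos a * circleCos b + circleSin a * circleSin b := by
  rw [sub_eq_add_neg, circleCos_add]
  have h1 : circleCos (-b) = circleCos b := Real.Angle.cos_neg b
  have h2 : circleSin (-b) = -circleSin b := Real.Angle.sin_neg b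
  rw [h1, h2]
  ring

/-- The endomorphism `(u, v) ↦ (u - v, u + v)`. -/
noncomputable def subAddHom (G : Type*) [AddCommGroup G] : G × G →+ G × G :=
  (AddMonoidHom.fst G G - AddMonoidHom.snd G G).prod (AddMonoidHom.fst G G + AddMonoidHom.snd G G)

theorem subAddHom_apply {G : Type*} [AddCommGroup G] (p : G × G) :
    subAddHom G p = (p.1 - p.2, p.1 + p.2) := rfl

theorem surjective_subAddHom {G : Type*} [AddCommGroup G] (h : ∀ a : G, ∃ b, b + b = a) :
    Function.Surjective (subAddHom G) := by
  rintro ⟨t, f⟩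
  obtain ⟨t, rfl⟩ := h t
  obtain ⟨f, rfl⟩ := h f
  refine ⟨(f + t, f - t), ?_⟩
  rw [subAddHom_apply]
  ext <;> simp only <;> abel

theorem exists_add_self_torus {V : Type*} (a : V → AddCircle (2 * π)) : ∃ b, b + b = a := by
  have h (z : AddCircle (2 * π)) : ∃ w, w + w = z := by
    induction z using QuotientAddGroup.induction_on with
    | H r => exact ⟨((r / 2 : ℝ) : AddCircle (2 * π)), by rw [← AddCircle.coe_add, add_halves]⟩
  choose f hf using h
  exact ⟨fun v => f (a v), funext fun v => hf _⟩

section Torus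

variable {V : Type*} [Fintype V]

/-- The free-boundary XY Hamiltonian with couplings `J`, on the torus. -/
noncomputable def torusEnergy (J : V → V → ℝ) (θ : V → AddCircle (2 * π)) : ℝ :=
  ∑ k, ∑ l, J k l * circleCos (θ k - θ l)

@[fun_prop]
theorem continuous_torusEnergy (J : V → V → ℝ) : Continuous (torusEnergy J) := by
  unfold torusEnergy
  fun_prop

theorem measurePreserving_subAddHom_torus :
    MeasurePreserving (subAddHom (V → AddCircle (2 * π)))
      ((volume : Measure (V → AddCircle (2 * π))).prod volume)
      ((volume : Measure (V → AddCircle (2 * π))).prod volume) := by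
  have : (volume : Measure (V → AddCircle (2 * π))).IsAddHaarMeasure :=
    Measure.pi.isAddHaarMeasure _
  have : ((volume : Measure (V → AddCircle (2 * π))).prod
      (volume : Measure (V → AddCircle (2 * π)))).IsAddHaarMeasure :=
    Measure.prod.instIsAddHaarMeasure _ _
  exact AddMonoidHom.measurePreserving
    ((continuous_fst.sub continuous_snd).prodMk (continuous_fst.add continuous_snd))
    (surjective_subAddHom exists_add_self_torus) rfl

/-- Ginibre's inequality for the duplicated XY model at two different temperatures. -/
theorem integral_duplicate_nonneg (J : V → V → ℝ) (hJ : ∀ k l, 0 ≤ J k l) (x y : V)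
    {b b' : ℝ} (hb : 0 ≤ b) (hbb' : b ≤ b') :
    0 ≤ ∫ p : (V → AddCircle (2 * π)) × (V → AddCircle (2 * π)),
      (circleCos (p.1 x - p.1 y) - circleCos (p.2 x - p.2 y)) *
        Real.exp (b' * torusEnergy J p.1 + b * torusEnergy J p.2) := by
  have hcont : Continuous fun p : (V → AddCircle (2 * π)) × (V → AddCircle (2 * π)) =>
      (circleCos (p.1 x - p.1 y) - circleCos (p.2 x - p.2 y)) *
        Real.exp (b' * torusEnergy J p.1 + b * torusEnergy J p.2) := by fun_prop
  rw [Measure.volume_eq_prod, ← measurePreserving_subAddHom_torus.map_eq, integral_map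
    measurePreserving_subAddHom_torus.measurable.aemeasurable hcont.aestronglyMeasurable]
  have key := integral_kernel_exp_nonneg (volume : Measure (V → AddCircle (2 * π)))
    (ι := (V × V) ⊕ (V × V))
    (Sum.elim (fun e => (b' + b) * J e.1 e.2) (fun e => (b' - b) * J e.1 e.2))
    (by
      rintro (e | e)
      · exact mul_nonneg (by linarith) (hJ _ _)
      · exact mul_nonneg (by linarith) (hJ _ _))
    (Sum.elim (fun e θ => circleCos (θ e.1 - θ e.2)) (fun e θ => circleSin (θ e.1 - θ e.2)))
    (by rintro (e | e) <;> simp only [Sum.elim_inl, Sum.elim_inr] <;> fun_prop)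
    (fun θ => circleSin (θ x - θ y)) (by fun_prop)
  refine (mul_nonneg zero_le_two key).trans_eq ?_
  rw [← integral_const_mul]
  refine integral_congr_ae (.of_forall fun p => ?_)
  have hs (k l : V) : (p.1 - p.2) k - (p.1 - p.2) l = (p.1 k - p.1 l) - (p.2 k - p.2 l) := by
    simp only [Pi.sub_apply]; abel
  have ha (k l : V) : (p.1 + p.2) k - (p.1 + p.2) l = (p.1 k - p.1 l) + (p.2 k - p.2 l) := by
    simp only [Pi.add_apply]; abel
  simp only [subAddHom_apply, torusEnergy, hs, ha, circleCos_add, circleCos_sub,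
    Fintype.sum_sum_type, Sum.elim_inl, Sum.elim_inr, Fintype.sum_prod_type]
  rw [← mul_assoc]
  congr 1
  · ring
  · congr 1
    simp only [Finset.mul_sum, ← Finset.sum_add_distrib]
    exact Finset.sum_congr rfl fun k _ => Finset.sum_congr rfl fun l _ => by ring

theorem torus_corr_monotone (J : V → V → ℝ) (hJ : ∀ k l, 0 ≤ J k l) (x y : V)
    {b b' : ℝ} (hb : 0 ≤ b) (hbb' : b ≤ b') :
    (∫ θ : V → AddCircle (2 * π), circleCos (θ x - θ y) * Real.exp (b * torusEnergy J θ)) /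
        (∫ θ : V → AddCircle (2 * π), Real.exp (b * torusEnergy J θ)) ≤
      (∫ θ : V → AddCircle (2 * π), circleCos (θ x - θ y) * Real.exp (b' * torusEnergy J θ)) /
        (∫ θ : V → AddCircle (2 * π), Real.exp (b' * torusEnergy J θ)) := by
  have hexp (c : ℝ) : Integrable fun θ : V → AddCircle (2 * π) =>
      Real.exp (c * torusEnergy J θ) :=
    Continuous.integrable_of_hasCompactSupport (by fun_prop) (.of_compactSpace _)
  have hcos (c : ℝ) : Integrable fun θ : V → AddCircle (2 * π) =>
      circleCos (θ x - θ y) * Real.exp (c * torusEnergy J θ) :=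
    Continuous.integrable_of_hasCompactSupport (by fun_prop) (.of_compactSpace _)
  rw [div_le_div_iff₀ (integral_exp_pos (hexp b)) (integral_exp_pos (hexp b')), ← sub_nonneg]
  refine (integral_duplicate_nonneg J hJ x y hb hbb').trans_eq ?_
  rw [mul_comm (∫ θ : V → AddCircle (2 * π), circleCos (θ x - θ y) * Real.exp (b * _)),
    ← integral_prod_mul, ← integral_prod_mul, ← integral_sub ((hcos b').mul_prod (hexp b))
    ((hexp b').mul_prod (hcos b)), Measure.volume_eq_prod]
  refine integral_congr_ae (.of_forall fun p => ?_)
  simp only [Real.exp_add]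
  ring

/-- Coordinatewise reduction modulo `2π` is measure preserving from the cube to the torus. -/
theorem measurePreserving_cube_torus :
    MeasurePreserving (fun (θ : V → ℝ) (k : V) => (θ k : AddCircle (2 * π)))
      (volume.restrict (Set.univ.pi fun _ => Set.Icc 0 (2 * π))) volume := by
  rw [volume_pi, volume_pi, Measure.restrict_pi_pi]
  refine measurePreserving_pi _ _ fun _ => ?_
  rw [← Measure.restrict_congr_set Ioc_ae_eq_Icc]
  simpa using AddCircle.measurePreserving_mk (2 * π) 0

end Torus

theorem setIntegral_cube_eq (L : ℕ) (F : (interF L → AddCircle (2 * π)) → ℝ) (hF : Continuous F) :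
    ∫ θ in cube L, F (fun k => (θ k : AddCircle (2 * π))) = ∫ t, F t := by
  rw [← measurePreserving_cube_torus.map_eq,
    integral_map measurePreserving_cube_torus.measurable.aemeasurable hF.aestronglyMeasurable]
  rfl

theorem energy0_eq_torusEnergy (L : ℕ) (β : ℝ) (θ : Cfg L) :
    energy0 L β θ = β / 6 * torusEnergy (fun k l : interF L => if adj k.1 l.1 then 1 else 0)
      (fun k => (θ k : AddCircle (2 * π))) := by
  simp only [energy0, torusEnergy, ite_mul, one_mul, zero_mul, ← AddCircle.coe_sub, circleCos_coe]

theorem corr0_eq_torus (L : ℕ) (β : ℝ) (x y : interF L) :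
    corr0 L β x y =
      (∫ θ : interF L → AddCircle (2 * π), circleCos (θ x - θ y) *
        Real.exp (β / 6 * torusEnergy (fun k l => if adj k.1 l.1 then 1 else 0) θ)) /
      (∫ θ : interF L → AddCircle (2 * π),
        Real.exp (β / 6 * torusEnergy (fun k l => if adj k.1 l.1 then 1 else 0) θ)) := by
  rw [← setIntegral_cube_eq L _ (by fun_prop), ← setIntegral_cube_eq L _ (by fun_prop)]
  simp only [corr0, avg0, val, x.2, y.2, dite_true, energy0_eq_torusEnergy, ← AddCircle.coe_sub,
    circleCos_coe, Subtype.coe_eta]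

/-- The free-boundary two-point function is nondecreasing in `β`. -/
theorem corr0_monotone_in_beta
    (L : ℕ) (hL : 2 ≤ L) (x y : Site) (hx : x ∈ interF L) (hy : y ∈ interF L)
    (β β' : ℝ) (hβ : 0 < β) (hββ' : β ≤ β') :
    corr0 L β x y ≤ corr0 L β' x y := by
  exact ((corr0_eq_torus L β ⟨x, hx⟩ ⟨y, hy⟩).trans_le (torus_corr_monotone _
    (fun k l => by split_ifs <;> norm_num) _ _ (by positivity) (by gcongr))).trans_eq
    (corr0_eq_torus L β' ⟨x, hx⟩ ⟨y, hy⟩).symm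
end

section
/- Second Griffiths-type inequality for the plus-boundary XY model: for every β > 0, every L ≥ 2 and all x, y ∈ Λ_L°, ⟨cos θ_x · cos θ_y⟩_{L,+,β} ≥ ⟨cos θ_x⟩_{L,+,β} · ⟨cos θ_y⟩_{L,+,β}. -/
open MeasureTheory Real Filter

/-- The kernel `exp (∑ e, J e * f e a * f e b)`, with `J ≥ 0`, is positive semidefinite. -/
theorem integral_prod_mul_exp_sum_nonneg {X E : Type*} [TopologicalSpace X] [CompactSpace X]
    [SecondCountableTopology X] [MeasurableSpace X] [BorelSpace X]
    (μ : Measure X) [IsFiniteMeasure μ] [Fintype E] {J : E → ℝ} (hJ : ∀ e, 0 ≤ J e)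
    {f : E → X → ℝ} (hf : ∀ e, Continuous (f e)) {φ : X → ℝ} (hφ : Continuous φ) :
    0 ≤ ∫ p : X × X, φ p.1 * φ p.2 * Real.exp (∑ e, J e * (f e p.1 * f e p.2)) ∂μ.prod μ := by
  have hint : ∀ {g : X × X → ℝ}, Continuous g → Integrable g (μ.prod μ) := fun hg =>
    hg.integrable_of_hasCompactSupport (HasCompactSupport.of_compactSpace _)
  set K : X × X → ℝ := fun p => ∑ e, J e * (f e p.1 * f e p.2) with hK
  have hKc : Continuous K := by fun_prop
  have hpow : ∀ (n : ℕ) (φ : X → ℝ), Continuous φ →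
      0 ≤ ∫ p : X × X, φ p.1 * φ p.2 * K p ^ n ∂μ.prod μ := by
    intro n
    induction n with
    | zero =>
      intro φ hφ
      simp only [pow_zero, mul_one, integral_prod_mul]
      exact mul_self_nonneg _
    | succ n ih =>
      intro φ hφ
      have hexp : ∀ p : X × X, φ p.1 * φ p.2 * K p ^ (n + 1)
          = ∑ e, J e * ((φ p.1 * f e p.1) * (φ p.2 * f e p.2) * K p ^ n) := by
        intro p
        rw [pow_succ]
        conv_lhs => rw [hK]
        simp only [Finset.mul_sum]
        exact Finset.sum_congr rfl fun e _ => by ring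
      simp only [hexp]
      rw [integral_finsetSum _ fun e _ => hint (by have := hf e; fun_prop)]
      refine Finset.sum_nonneg fun e _ => ?_
      rw [integral_const_mul]
      exact mul_nonneg (hJ e) (ih (fun x => φ x * f e x) (hφ.mul (hf e)))
  have hsum : HasSum (fun n : ℕ => ∫ p : X × X, φ p.1 * φ p.2 * (K p ^ n / n.factorial) ∂μ.prod μ)
      (∫ p : X × X, φ p.1 * φ p.2 * Real.exp (K p) ∂μ.prod μ) := by
    have hser : ∀ t : ℝ, HasSum (fun n : ℕ => t ^ n / n.factorial) (Real.exp t) := fun t => by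
      rw [Real.exp_eq_exp_ℝ]
      exact NormedSpace.expSeries_div_hasSum_exp t
    refine hasSum_integral_of_dominated_convergence
      (fun n p => |φ p.1 * φ p.2| * (|K p| ^ n / n.factorial)) (fun n => ?_) (fun n => ?_) ?_ ?_ ?_
    · exact (hint (by fun_prop)).1
    · exact Eventually.of_forall fun p => by
        rw [Real.norm_eq_abs, abs_mul, abs_div, abs_pow, Nat.abs_cast]
    · exact Eventually.of_forall fun p => ((hser |K p|).mul_left _).summable
    · simp only [fun p : X × X => ((hser |K p|).mul_left |φ p.1 * φ p.2|).tsum_eq]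
      exact hint (by fun_prop)
    · exact Eventually.of_forall fun p => (hser (K p)).mul_left _
  refine hsum.nonneg fun n => ?_
  have : ∀ p : X × X, φ p.1 * φ p.2 * (K p ^ n / n.factorial)
      = (φ p.1 * φ p.2 * K p ^ n) / n.factorial := fun p => by ring
  simp only [this, integral_div]
  exact div_nonneg (hpow n φ hφ) (Nat.cast_nonneg _)

/-- On a 2-divisible compact group, `(a, b) ↦ (a - b, a + b)` preserves the Haar measure. -/
theorem measurePreserving_sub_add {X : Type*} [AddCommGroup X] [TopologicalSpace X]
    [IsTopologicalAddGroup X] [CompactSpace X] [SecondCountableTopology X] [MeasurableSpace X]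
    [BorelSpace X] (μ : Measure X) [μ.IsAddHaarMeasure]
    (hdiv : ∀ x : X, ∃ y, y + y = x) :
    MeasurePreserving (fun p : X × X => (p.1 - p.2, p.1 + p.2)) (μ.prod μ) (μ.prod μ) := by
  let F : X × X →+ X × X :=
    (AddMonoidHom.fst X X - AddMonoidHom.snd X X).prod (AddMonoidHom.fst X X + AddMonoidHom.snd X X)
  refine AddMonoidHom.measurePreserving (f := F) ?_ ?_ rfl
  · change Continuous fun p : X × X => (p.1 - p.2, p.1 + p.2)
    fun_prop
  · rintro ⟨u, v⟩
    obtain ⟨b, hb⟩ := hdiv (v - u)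
    refine ⟨(u + b, b), Prod.ext ?_ ?_⟩
    · change u + b - b = u
      abel
    · change u + b + b = v
      rw [add_assoc, hb]
      abel

/-- Ginibre's inequality for cosines of characters on a 2-divisible compact group. -/
theorem ginibre_inequality {X E : Type*} [AddCommGroup X] [TopologicalSpace X]
    [IsTopologicalAddGroup X] [CompactSpace X] [SecondCountableTopology X] [MeasurableSpace X]
    [BorelSpace X] (μ : Measure X) [μ.IsAddHaarMeasure] (hdiv : ∀ x : X, ∃ y, y + y = x)
    [Fintype E] {J : E → ℝ} (hJ : ∀ e, 0 ≤ J e)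
    {ψ : E → X →+ Real.Angle} (hψ : ∀ e, Continuous (ψ e))
    {χ η : X →+ Real.Angle} (hχ : Continuous χ) (hη : Continuous η) :
    (∫ a, (χ a).cos * Real.exp (∑ e, J e * (ψ e a).cos) ∂μ) *
        (∫ a, (η a).cos * Real.exp (∑ e, J e * (ψ e a).cos) ∂μ) ≤
      (∫ a, (χ a).cos * (η a).cos * Real.exp (∑ e, J e * (ψ e a).cos) ∂μ) *
        ∫ a, Real.exp (∑ e, J e * (ψ e a).cos) ∂μ := by
  have hcos := Real.Angle.continuous_cos
  have hsin := Real.Angle.continuous_sin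
  have hint : ∀ {g : X × X → ℝ}, Continuous g → Integrable g (μ.prod μ) := fun hg =>
    hg.integrable_of_hasCompactSupport (HasCompactSupport.of_compactSpace _)
  set w : X → ℝ := fun a => Real.exp (∑ e, J e * (ψ e a).cos) with hw
  have hwc : Continuous w := by fun_prop
  let D : X × X → ℝ := fun p =>
    ((χ p.1).cos - (χ p.2).cos) * ((η p.1).cos - (η p.2).cos) * (w p.1 * w p.2)
  have hD : Continuous D := by fun_prop
  have hsplit : ∫ p, D p ∂μ.prod μ =
      2 * ((∫ a, (χ a).cos * (η a).cos * w a ∂μ) * ∫ a, w a ∂μ) -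
        2 * ((∫ a, (χ a).cos * w a ∂μ) * ∫ a, (η a).cos * w a ∂μ) := by
    have h1 : ∀ p, D p =
        ((χ p.1).cos * (η p.1).cos * w p.1) * w p.2 +
          w p.1 * ((χ p.2).cos * (η p.2).cos * w p.2) -
        (((χ p.1).cos * w p.1) * ((η p.2).cos * w p.2) +
          ((η p.1).cos * w p.1) * ((χ p.2).cos * w p.2)) := fun p => by
      simp only [D]; ring
    simp only [h1]
    rw [integral_sub (hint (by fun_prop)) (hint (by fun_prop)),
      integral_add (hint (by fun_prop)) (hint (by fun_prop)),
      integral_add (hint (by fun_prop)) (hint (by fun_prop)),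
      integral_prod_mul (fun a => (χ a).cos * (η a).cos * w a) w,
      integral_prod_mul w (fun a => (χ a).cos * (η a).cos * w a),
      integral_prod_mul (fun a => (χ a).cos * w a) (fun a => (η a).cos * w a),
      integral_prod_mul (fun a => (η a).cos * w a) (fun a => (χ a).cos * w a)]
    ring
  have hrot : ∀ p : X × X, D (p.1 - p.2, p.1 + p.2) =
      4 * (((χ p.1).sin * (η p.1).sin) * ((χ p.2).sin * (η p.2).sin) *
        Real.exp (∑ e, (2 * J e) * ((ψ e p.1).cos * (ψ e p.2).cos))) := fun p => by
    have hsumcos : (∑ e, J e * (ψ e (p.1 - p.2)).cos) + ∑ e, J e * (ψ e (p.1 + p.2)).cos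
        = ∑ e, (2 * J e) * ((ψ e p.1).cos * (ψ e p.2).cos) := by
      rw [← Finset.sum_add_distrib]
      refine Finset.sum_congr rfl fun e _ => ?_
      rw [map_sub, map_add, sub_eq_add_neg, Real.Angle.cos_add, Real.Angle.cos_add,
        Real.Angle.cos_neg, Real.Angle.sin_neg]
      ring
    simp only [D, hw]
    rw [← Real.exp_add, hsumcos]
    simp only [map_neg, map_add, sub_eq_add_neg, Real.Angle.cos_add, Real.Angle.cos_neg,
      Real.Angle.sin_neg]
    ring
  have hnn : 0 ≤ ∫ p, D p ∂μ.prod μ := by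
    have hmp := measurePreserving_sub_add μ hdiv
    rw [← hmp.map_eq, integral_map hmp.measurable.aemeasurable hD.aestronglyMeasurable]
    simp only [hrot, integral_const_mul]
    exact mul_nonneg (by norm_num) (integral_prod_mul_exp_sum_nonneg μ
      (J := fun e => 2 * J e) (fun e => mul_nonneg zero_le_two (hJ e))
      (f := fun e a => (ψ e a).cos) (fun e => hcos.comp (hψ e))
      (φ := fun a => (χ a).sin * (η a).sin) ((hsin.comp hχ).mul (hsin.comp hη)))
  linarith

instance fact_zero_lt_two_pi : Fact (0 < 2 * π) := ⟨Real.two_pi_pos⟩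

/-- The projection of angle configurations to the torus carries Lebesgue measure on the cube to
the Haar measure. -/
theorem measurePreserving_cube (L : ℕ) :
    MeasurePreserving (fun (θ : Cfg L) k => (θ k : AddCircle (2 * π)))
      (volume.restrict (cube L)) (Measure.pi fun _ : ↥(interF L) => (volume : Measure (AddCircle (2 * π)))) := by
  have h : (volume.restrict (cube L) : Measure (Cfg L)) =
      Measure.pi fun _ => volume.restrict (Set.Ioc 0 (0 + 2 * π)) := by
    rw [cube, volume_pi, Measure.restrict_pi_pi]
    simp only [zero_add, restrict_Ioc_eq_restrict_Icc]
  rw [h]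
  exact measurePreserving_pi _ _ fun _ => AddCircle.measurePreserving_mk (2 * π) 0

/-- The identification of `AddCircle (2 * π)` with `Real.Angle`. -/
noncomputable def addCircleToAngle : AddCircle (2 * π) →+ Real.Angle := AddMonoidHom.id (AddCircle (2 * π))

theorem continuous_addCircleToAngle : Continuous addCircleToAngle :=
  (continuous_id : Continuous (id : AddCircle (2 * π) → AddCircle (2 * π)))

theorem addCircleToAngle_coe (t : ℝ) : addCircleToAngle (t : AddCircle (2 * π)) = (t : Real.Angle) :=
  rfl

/-- The `k`-th coordinate angle on the torus. -/
noncomputable def coordAngle {ι : Type*} (k : ι) : (ι → AddCircle (2 * π)) →+ Real.Angle :=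
  addCircleToAngle.comp (Pi.evalAddMonoidHom _ k)

theorem continuous_coordAngle {ι : Type*} (k : ι) : Continuous (coordAngle k) :=
  continuous_addCircleToAngle.comp (continuous_apply k)

theorem coordAngle_coe {ι : Type*} (k : ι) (θ : ι → ℝ) :
    coordAngle k (fun j => (θ j : AddCircle (2 * π))) = (θ k : Real.Angle) :=
  rfl

/-- Nonnegative couplings of the plus-boundary energy, indexed by ordered pairs and sites. -/
noncomputable def plusCoupling (L : ℕ) (β : ℝ) :
    (↥(interF L) × ↥(interF L)) ⊕ ↥(interF L) → ℝ :=
  Sum.elim (fun p => if adj p.1.1 p.2.1 then β / 6 else 0) (fun k => β / 3 * nBd L k.1)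

/-- The characters whose cosines enter the plus-boundary energy. -/
noncomputable def plusCharacter (L : ℕ) :
    (↥(interF L) × ↥(interF L)) ⊕ ↥(interF L) →
      (↥(interF L) → AddCircle (2 * π)) →+ Real.Angle :=
  Sum.elim (fun p => coordAngle p.1 - coordAngle p.2) coordAngle

theorem continuous_plusCharacter (L : ℕ) (e) : Continuous (plusCharacter L e) := by
  rcases e with p | k
  · exact (continuous_coordAngle p.1).sub (continuous_coordAngle p.2)
  · exact continuous_coordAngle k

theorem plusCoupling_nonneg (L : ℕ) {β : ℝ} (hβ : 0 ≤ β) (e) : 0 ≤ plusCoupling L β e := by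
  rcases e with p | k
  · simp only [plusCoupling, Sum.elim_inl]
    split_ifs <;> positivity
  · simp only [plusCoupling, Sum.elim_inr]
    positivity

theorem energyP_eq_sum (L : ℕ) (β : ℝ) (θ : Cfg L) :
    energyP L β θ = ∑ e, plusCoupling L β e *
      (plusCharacter L e fun k => (θ k : AddCircle (2 * π))).cos := by
  simp only [energyP, energy0, plusCoupling, plusCharacter, Fintype.sum_sum_type, Sum.elim_inl,
    Sum.elim_inr, Fintype.sum_prod_type, AddMonoidHom.sub_apply, coordAngle_coe,
    ← Real.Angle.coe_sub, Real.Angle.cos_coe, Finset.mul_sum]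
  congr 1
  · refine Finset.sum_congr rfl fun k _ => Finset.sum_congr rfl fun l _ => ?_
    split_ifs <;> simp
  · exact Finset.sum_congr rfl fun k _ => by ring

theorem AddCircle.exists_add_self_eq {T : ℝ} (x : AddCircle T) : ∃ y, y + y = x := by
  induction x using QuotientAddGroup.induction_on with
  | H r => exact ⟨((r / 2 : ℝ) : AddCircle T), by rw [← AddCircle.coe_add, add_halves]⟩

/-- Second Griffiths-type inequality for the plus-boundary XY model. -/
theorem griffiths_second_inequality_plus
    (β : ℝ) (hβ : 0 < β) (L : ℕ) (hL : 2 ≤ L)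
    (x y : Site) (hx : x ∈ interF L) (hy : y ∈ interF L) :
    avgP L β (fun θ => Real.cos (val L θ x)) * avgP L β (fun θ => Real.cos (val L θ y))
      ≤ avgP L β (fun θ => Real.cos (val L θ x) * Real.cos (val L θ y)) := by
  let w : (↥(interF L) → AddCircle (2 * π)) → ℝ := fun a =>
    Real.exp (∑ e, plusCoupling L β e * (plusCharacter L e a).cos)
  have hcos := Real.Angle.continuous_cos
  have hcoord := fun k : ↥(interF L) => continuous_coordAngle k
  have hchar := continuous_plusCharacter L
  have hwc : Continuous w := by fun_prop
  have transfer : ∀ G : (↥(interF L) → AddCircle (2 * π)) → ℝ, Continuous G →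
      ∫ θ in cube L, G (fun k => (θ k : AddCircle (2 * π))) =
        ∫ a, G a ∂Measure.pi fun _ => (volume : Measure (AddCircle (2 * π))) := fun G hG => by
    have hmp := measurePreserving_cube L
    rw [← hmp.map_eq, integral_map hmp.measurable.aemeasurable hG.aestronglyMeasurable]
  have key := ginibre_inequality
    (Measure.pi fun _ : ↥(interF L) => (volume : Measure (AddCircle (2 * π))))
    (fun a => by
      choose b hb using fun k => AddCircle.exists_add_self_eq (a k)
      exact ⟨b, funext hb⟩)
    (plusCoupling_nonneg L hβ.le) hchar (hcoord ⟨x, hx⟩) (hcoord ⟨y, hy⟩)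
  rw [← transfer (fun a => (coordAngle ⟨x, hx⟩ a).cos * w a) (by fun_prop),
    ← transfer (fun a => (coordAngle ⟨y, hy⟩ a).cos * w a) (by fun_prop),
    ← transfer (fun a => (coordAngle ⟨x, hx⟩ a).cos * (coordAngle ⟨y, hy⟩ a).cos * w a)
      (by fun_prop), ← transfer w hwc] at key
  simp only [w, ← energyP_eq_sum, coordAngle_coe, Real.Angle.cos_coe] at key
  simp only [avgP, val, hx, hy, dif_pos]
  set Z := ∫ θ in cube L, Real.exp (energyP L β θ)
  have hZ : 0 ≤ Z := integral_nonneg fun θ => (Real.exp_pos _).le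
  rcases hZ.eq_or_lt with h0 | h0
  · simp [← h0]
  · rw [div_mul_div_comm, div_le_div_iff₀ (mul_pos h0 h0) h0, ← mul_assoc]
    exact mul_le_mul_of_nonneg_right key hZ
end

section
/- Translation invariance of the infinite-volume plus-boundary magnetization: for every β > 0 and every y ∈ ℤ³, inf_{L > ‖y‖_∞} ⟨cos θ_y⟩_{L,+,β} = inf_{L ≥ 2} ⟨cos θ_0⟩_{L,+,β} = m*(β). -/
open MeasureTheory Real Filter

theorem Continuous.integrable_of_compactSpace {X : Type*} [TopologicalSpace X] [CompactSpace X]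
    [MeasurableSpace X] [OpensMeasurableSpace X] {μ : Measure X} [IsFiniteMeasure μ]
    {f : X → ℝ} (hf : Continuous f) : Integrable f μ :=
  hf.integrable_of_hasCompactSupport (HasCompactSupport.of_compactSpace f)

section PositiveKernel

variable {X : Type*} [TopologicalSpace X] [CompactSpace X] [SecondCountableTopology X]
  [MeasurableSpace X] [BorelSpace X] (μ : Measure X) [IsFiniteMeasure μ]
  {J : Type*} [Fintype J] {c : J → ℝ} {f : J → X → ℝ}

theorem integral_mul_sum_pow_nonneg (hc : ∀ j, 0 ≤ c j) (hf : ∀ j, Continuous (f j)) (n : ℕ) :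
    ∀ g : X → ℝ, Continuous g →
      0 ≤ ∫ z, g z.1 * g z.2 * (∑ j, c j * (f j z.1 * f j z.2)) ^ n ∂(μ.prod μ) := by
  induction n with
  | zero =>
    intro g _
    simp only [pow_zero, mul_one, integral_prod_mul g g]
    exact mul_self_nonneg _
  | succ n ih =>
    intro g hg
    have expand : ∀ z : X × X, g z.1 * g z.2 * (∑ j, c j * (f j z.1 * f j z.2)) ^ (n + 1) =
        ∑ j, c j * ((g z.1 * f j z.1) * (g z.2 * f j z.2) *
          (∑ j, c j * (f j z.1 * f j z.2)) ^ n) := by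
      intro z
      rw [pow_succ', ← mul_assoc, Finset.mul_sum, Finset.sum_mul]
      exact Finset.sum_congr rfl fun j _ => by ring
    simp_rw [expand]
    rw [integral_finsetSum _ fun j _ => Continuous.integrable_of_compactSpace (by fun_prop)]
    refine Finset.sum_nonneg fun j _ => ?_
    rw [integral_const_mul]
    exact mul_nonneg (hc j) (ih (fun x => g x * f j x) (hg.mul (hf j)))

theorem integral_mul_exp_sum_nonneg (hc : ∀ j, 0 ≤ c j) (hf : ∀ j, Continuous (f j))
    {g : X → ℝ} (hg : Continuous g) :
    0 ≤ ∫ z, g z.1 * g z.2 * exp (∑ j, c j * (f j z.1 * f j z.2)) ∂(μ.prod μ) := by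
  set K : X × X → ℝ := fun z => ∑ j, c j * (f j z.1 * f j z.2)
  have hKc : Continuous K := by fun_prop
  have lim : Tendsto
      (fun n => ∫ z, g z.1 * g z.2 * ∑ i ∈ Finset.range n, K z ^ i / i.factorial ∂(μ.prod μ))
      atTop (nhds (∫ z, g z.1 * g z.2 * exp (K z) ∂(μ.prod μ))) := by
    refine tendsto_integral_of_dominated_convergence
      (fun z => |g z.1 * g z.2| * exp |K z|) (fun n => ?_) ?_ (fun n => ?_) ?_
    · exact Continuous.aestronglyMeasurable (by fun_prop)
    · exact Continuous.integrable_of_compactSpace (by fun_prop)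
    · refine ae_of_all _ fun z => ?_
      rw [norm_eq_abs, abs_mul]
      gcongr
      refine (Finset.abs_sum_le_sum_abs _ _).trans ?_
      refine le_trans (le_of_eq ?_) (sum_le_exp_of_nonneg (abs_nonneg (K z)) n)
      simp [abs_div, abs_pow]
    · refine ae_of_all _ fun z => Tendsto.const_mul _ ?_
      rw [exp_eq_exp_ℝ]
      exact (NormedSpace.expSeries_div_hasSum_exp (K z)).tendsto_sum_nat
  refine ge_of_tendsto' lim fun n => ?_
  simp_rw [Finset.mul_sum]
  rw [integral_finsetSum _ fun j _ => Continuous.integrable_of_compactSpace (by fun_prop)]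
  refine Finset.sum_nonneg fun i _ => ?_
  simp_rw [← mul_div_assoc]
  rw [integral_div]
  exact div_nonneg (integral_mul_sum_pow_nonneg μ hc hf i g hg) (by positivity)

end PositiveKernel

local instance factTwoPiPos : Fact (0 < 2 * π) := ⟨two_pi_pos⟩

/-- The circle of angles. -/
abbrev AngleCircle : Type := AddCircle (2 * π)

namespace AngleCircle

noncomputable def cos (x : AngleCircle) : ℝ := Real.Angle.cos x

noncomputable def sin (x : AngleCircle) : ℝ := Real.Angle.sin x

@[simp] theorem cos_coe (t : ℝ) : cos (t : AngleCircle) = Real.cos t := Real.Angle.cos_coe t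

@[fun_prop] theorem continuous_cos : Continuous cos := Real.Angle.continuous_cos

@[fun_prop] theorem continuous_sin : Continuous sin := Real.Angle.continuous_sin

theorem cos_add (x y : AngleCircle) : cos (x + y) = cos x * cos y - sin x * sin y :=
  Real.Angle.cos_add x y

theorem cos_sub (x y : AngleCircle) : cos (x - y) = cos x * cos y + sin x * sin y := by
  induction x using QuotientAddGroup.induction_on with | H a =>
  induction y using QuotientAddGroup.induction_on with | H b =>
  exact Real.cos_sub a b

theorem neg_one_le_cos (x : AngleCircle) : -1 ≤ cos x := by
  induction x using QuotientAddGroup.induction_on with | H a =>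
  exact Real.neg_one_le_cos a

theorem exists_add_self_eq (x : AngleCircle) : ∃ y, y + y = x := by
  induction x using QuotientAddGroup.induction_on with | H a =>
  exact ⟨((a / 2 : ℝ) : AngleCircle), by rw [← AddCircle.coe_add, add_halves]⟩

end AngleCircle

section Ginibre

variable {G : Type*} [AddCommGroup G] [TopologicalSpace G] [IsTopologicalAddGroup G]
  [CompactSpace G] [SecondCountableTopology G] [MeasurableSpace G] [BorelSpace G]
  (μ : Measure G) [μ.IsAddHaarMeasure] [IsProbabilityMeasure μ]
  {J : Type*} [Fintype J] {c : J → ℝ} {m : J → G →+ AngleCircle} {χ : G →+ AngleCircle}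
  {P : G →+ G}

open AngleCircle in
/-- Ginibre's inequality for a ferromagnetic Hamiltonian on a divisible compact abelian group:
constraining the configuration to the image of an endomorphism increases `cos χ`. -/
theorem ginibre_endomorphism (hdiv : ∀ g : G, ∃ h, h + h = g) (hc : ∀ j, 0 ≤ c j)
    (hm : ∀ j, Continuous (m j)) (hχ : Continuous χ) (hP : Continuous P) :
    (∫ θ, cos (χ θ) * exp (∑ j, c j * cos (m j θ)) ∂μ) *
        (∫ θ, exp (∑ j, c j * cos (m j (P θ))) ∂μ) ≤
      (∫ θ, cos (χ (P θ)) * exp (∑ j, c j * cos (m j (P θ))) ∂μ) *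
        (∫ θ, exp (∑ j, c j * cos (m j θ)) ∂μ) := by
  let Ψ : G × (G × G) →+ G × G :=
    { toFun := fun z => (P (z.2.1 + z.2.2) + ((z.1 + z.1) - P (z.1 + z.1)), z.2.1 - z.2.2)
      map_zero' := by simp
      map_add' := fun z w => by
        ext
        · simp only [Prod.fst_add, Prod.snd_add, map_add]; abel
        · simp only [Prod.fst_add, Prod.snd_add]; abel }
  have hΨc : Continuous Ψ := by
    change Continuous fun z : G × (G × G) =>
      (P (z.2.1 + z.2.2) + ((z.1 + z.1) - P (z.1 + z.1)), z.2.1 - z.2.2)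
    fun_prop
  have hΨs : Function.Surjective Ψ := by
    rintro ⟨θ, η⟩
    obtain ⟨h, rfl⟩ := hdiv θ
    obtain ⟨k, rfl⟩ := hdiv η
    refine ⟨(h, h + k, h - k), ?_⟩
    change (P ((h + k) + (h - k)) + ((h + h) - P (h + h)), (h + k) - (h - k)) = _
    ext
    · simp only [map_add, map_sub]; abel
    · simp only []; abel
  have hpres : MeasurePreserving Ψ (μ.prod (μ.prod μ)) (μ.prod μ) :=
    AddMonoidHom.measurePreserving hΨc hΨs (by simp)
  have key : 0 ≤ ∫ z : G × G, (cos (χ (P z.2)) - cos (χ z.1)) *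
      exp (∑ j, c j * cos (m j z.1) + ∑ j, c j * cos (m j (P z.2))) ∂(μ.prod μ) := by
    rw [← hpres.map_eq, integral_map hΨc.aemeasurable
      (Continuous.aestronglyMeasurable (by fun_prop)), integral_prod _
      (Continuous.integrable_of_compactSpace (by fun_prop))]
    refine integral_nonneg fun t => ?_
    have pos := integral_mul_exp_sum_nonneg μ (c := fun j => 2 * c j)
      (f := fun j a => cos (m j (P a + (t - P t)))) (g := fun a => sin (χ (P a + (t - P t))))
      (fun j => by have := hc j; positivity) (fun j => by fun_prop) (by fun_prop)
    refine (mul_nonneg zero_le_two pos).trans (le_of_eq ?_)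
    rw [← integral_const_mul]
    refine integral_congr_ae (ae_of_all _ fun z => ?_)
    have h1 : (Ψ (t, z)).1 = (P z.1 + (t - P t)) + (P z.2 + (t - P t)) := by
      change P (z.1 + z.2) + ((t + t) - P (t + t)) = _
      simp only [map_add]; abel
    have h2 : P (Ψ (t, z)).2 = (P z.1 + (t - P t)) - (P z.2 + (t - P t)) := by
      change P (z.1 - z.2) = _
      simp only [map_sub]; abel
    simp only [h1, h2]
    generalize P z.1 + (t - P t) = a
    generalize P z.2 + (t - P t) = b
    simp only [map_add, map_sub, AngleCircle.cos_add, AngleCircle.cos_sub,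
      ← Finset.sum_add_distrib]
    have : ∀ j, c j * (cos (m j a) * cos (m j b) - sin (m j a) * sin (m j b)) +
        c j * (cos (m j a) * cos (m j b) + sin (m j a) * sin (m j b)) =
        2 * c j * (cos (m j a) * cos (m j b)) := fun j => by ring
    simp only [this]
    ring
  have split : ∀ z : G × G, (cos (χ (P z.2)) - cos (χ z.1)) *
      exp (∑ j, c j * cos (m j z.1) + ∑ j, c j * cos (m j (P z.2))) =
      exp (∑ j, c j * cos (m j z.1)) *
        (cos (χ (P z.2)) * exp (∑ j, c j * cos (m j (P z.2)))) -
      (cos (χ z.1) * exp (∑ j, c j * cos (m j z.1))) *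
        exp (∑ j, c j * cos (m j (P z.2))) := fun z => by rw [exp_add]; ring
  simp_rw [split] at key
  rw [integral_sub (Continuous.integrable_of_compactSpace (by fun_prop))
    (Continuous.integrable_of_compactSpace (by fun_prop)),
    integral_prod_mul (fun θ => exp (∑ j, c j * cos (m j θ)))
      (fun θ => cos (χ (P θ)) * exp (∑ j, c j * cos (m j (P θ)))),
    integral_prod_mul (fun θ => cos (χ θ) * exp (∑ j, c j * cos (m j θ)))
      (fun θ => exp (∑ j, c j * cos (m j (P θ))))] at key
  linarith

end Ginibre

section CutModel

/-- The normalized Haar measure on angle configurations. -/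
noncomputable abbrev angleMeasure (V : Type*) [Fintype V] : Measure (V → AngleCircle) :=
  Measure.pi fun _ => AddCircle.haarAddCircle

@[fun_prop] theorem continuous_indicator_angle {V : Type*} (S : Set V) :
    Continuous fun θ : V → AngleCircle => S.indicator θ := by
  classical
  refine continuous_pi fun k => ?_
  by_cases hk : k ∈ S
  · simpa [hk] using continuous_apply (A := fun _ : V => AngleCircle) k
  · simpa [hk] using continuous_const

variable (W : Finset Site) (β : ℝ)

/-- The XY energy of an angle configuration on `W`, with free boundary condition. -/
noncomputable def xyEnergy (θ : W → AngleCircle) : ℝ :=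
  ∑ j : W × W, (if adj j.1 j.2 then β / 6 else 0) * AngleCircle.cos (θ j.1 - θ j.2)

/-- The magnetization at `x` of the XY model on `W` with all spins outside `S` fixed to `0`. -/
noncomputable def cutMag (S : Set W) (x : W) : ℝ :=
  (∫ θ, AngleCircle.cos (S.indicator θ x) * exp (xyEnergy W β (S.indicator θ))
      ∂(angleMeasure W)) /
    ∫ θ, exp (xyEnergy W β (S.indicator θ)) ∂(angleMeasure W)

@[fun_prop] theorem continuous_xyEnergy : Continuous (xyEnergy W β) := by
  unfold xyEnergy; fun_prop

theorem integrable_exp_xyEnergy (S : Set W) :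
    Integrable (fun θ => exp (xyEnergy W β (S.indicator θ))) (angleMeasure W) := by
  exact Continuous.integrable_of_compactSpace (by fun_prop)

theorem integral_exp_xyEnergy_pos (S : Set W) :
    0 < ∫ θ, exp (xyEnergy W β (S.indicator θ)) ∂(angleMeasure W) :=
  integral_exp_pos (integrable_exp_xyEnergy W β S)

variable {W β}

theorem cutMag_anti (hβ : 0 < β) {S T : Set W} (hST : S ⊆ T) (x : W) :
    cutMag W β T x ≤ cutMag W β S x := by
  rw [cutMag, cutMag,
    div_le_div_iff₀ (integral_exp_xyEnergy_pos W β T) (integral_exp_xyEnergy_pos W β S)]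
  have h := ginibre_endomorphism (angleMeasure W)
    (c := fun j : W × W => if adj j.1 j.2 then β / 6 else 0)
    (m := fun j => (Pi.evalAddMonoidHom (fun _ : W => AngleCircle) j.1 -
      Pi.evalAddMonoidHom (fun _ : W => AngleCircle) j.2).comp (Set.indicatorHom AngleCircle T))
    (χ := (Pi.evalAddMonoidHom (fun _ : W => AngleCircle) x).comp
      (Set.indicatorHom AngleCircle T))
    (P := Set.indicatorHom AngleCircle S)
    (fun g => ⟨fun k => (AngleCircle.exists_add_self_eq (g k)).choose,
      funext fun k => (AngleCircle.exists_add_self_eq (g k)).choose_spec⟩)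
    (fun j => by positivity)
    (fun j => ((continuous_apply j.1).sub (continuous_apply j.2)).comp
      (continuous_indicator_angle T))
    ((continuous_apply x).comp (continuous_indicator_angle T)) (continuous_indicator_angle S)
  have happ : ∀ (A : Set W) (θ : W → AngleCircle), Set.indicatorHom AngleCircle A θ =
      A.indicator θ := fun _ _ => rfl
  simpa only [AddMonoidHom.comp_apply, AddMonoidHom.sub_apply, Pi.evalAddMonoidHom_apply, happ,
    Set.indicator_indicator, Set.inter_eq_right.2 hST, xyEnergy] using h

theorem neg_one_le_cutMag (S : Set W) (x : W) : -1 ≤ cutMag W β S x := by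
  rw [cutMag, le_div_iff₀ (integral_exp_xyEnergy_pos W β S), ← integral_const_mul]
  refine integral_mono ((integrable_exp_xyEnergy W β S).const_mul _)
    (Continuous.integrable_of_compactSpace (by fun_prop)) fun θ => ?_
  exact mul_le_mul_of_nonneg_right (AngleCircle.neg_one_le_cos _) (exp_pos _).le

end CutModel

theorem integral_cube_coe (L : ℕ) : ∃ c : ℝ, c ≠ 0 ∧ ∀ F : (interF L → AngleCircle) → ℝ,
    Continuous F → ∫ θ in cube L, F (fun k => (θ k : AngleCircle)) =
      c * ∫ φ, F φ ∂(angleMeasure (interF L)) := by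
  have hpres : MeasurePreserving (fun (θ : Cfg L) k => (θ k : AngleCircle))
      (volume.restrict (cube L)) (Measure.pi fun _ => volume) := by
    have h := measurePreserving_pi (fun _ : interF L => volume.restrict (Set.Ioc 0 (0 + 2 * π)))
      (fun _ => volume) (f := fun _ => QuotientAddGroup.mk)
      fun _ => AddCircle.measurePreserving_mk (2 * π) 0
    rwa [zero_add, Measure.restrict_congr_set Ioc_ae_eq_Icc, ← Measure.restrict_pi_pi] at h
  let ν : Measure (interF L → AngleCircle) := Measure.pi fun _ => volume
  refine ⟨ν.addHaarScalarFactor (angleMeasure (interF L)), ?_, fun F hF => ?_⟩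
  · exact_mod_cast (Measure.addHaarScalarFactor_pos_of_isAddHaarMeasure _ _).ne'
  · rw [← integral_map (φ := fun (θ : Cfg L) k => (θ k : AngleCircle)) hpres.aemeasurable
      hF.aestronglyMeasurable, hpres.map_eq,
      Measure.isAddInvariant_eq_smul_of_compactSpace (Measure.pi fun _ => volume)
        (angleMeasure (interF L)), integral_smul_nnreal_measure, NNReal.smul_def, smul_eq_mul]

theorem adj_sub_right (k l v : Site) : adj (k - v) (l - v) ↔ adj k l := by simp [adj]

theorem mem_lamF_of_adj {L : ℕ} {k l : Site} (hk : k ∈ interF L) (h : adj k l) :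
    l ∈ lamF L := by
  simp only [interF, lamF, Finset.mem_Icc, Pi.le_def] at hk ⊢
  have key : ∀ i, |k i - l i| ≤ 1 := fun i => by
    rw [← show _ = (1 : ℤ) from h]
    exact Finset.single_le_sum (f := fun i => |k i - l i|) (fun _ _ => abs_nonneg _)
      (Finset.mem_univ i)
  refine ⟨fun i => ?_, fun i => ?_⟩ <;>
  · have := abs_le.1 (key i)
    have := hk.1 i
    have := hk.2 i
    omega

theorem adj_comm (k l : Site) : adj k l ↔ adj l k := by
  simp only [adj, abs_sub_comm]

theorem interF_subset_lamF (L : ℕ) : interF L ⊆ lamF L := by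
  refine Finset.Icc_subset_Icc (fun i => ?_) (fun i => ?_) <;> simp

theorem val_of_notMem {L : ℕ} (θ : Cfg L) {x : Site} (hx : x ∉ interF L) : val L θ x = 0 :=
  dif_neg hx

theorem sum_boundary_eq {L : ℕ} {U : Finset Site} (hU : lamF L ⊆ U) {k : Site}
    (hk : k ∈ interF L) (a : ℝ) :
    (∑ l ∈ U \ interF L, if adj k l then a else 0) = nBd L k * a := by
  rw [← Finset.sum_filter, Finset.sum_const, nsmul_eq_mul, nBd]
  congr 3
  ext l
  simp only [Finset.mem_filter, Finset.mem_sdiff]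
  exact ⟨fun h => ⟨⟨mem_lamF_of_adj hk h.2, h.1.2⟩, h.2⟩,
    fun h => ⟨⟨hU h.1.1, h.1.2⟩, h.2⟩⟩

/-- Setting the spins outside the interior to `0` turns the free energy of a region containing
the box into the plus-boundary energy, up to a constant. -/
theorem energy_val_eq {L : ℕ} (β : ℝ) {U : Finset Site} (hU : lamF L ⊆ U) (θ : Cfg L) :
    (∑ k ∈ U, ∑ l ∈ U, (if adj k l then β / 6 else 0) * Real.cos (val L θ k - val L θ l)) =
      energyP L β θ +
        ∑ k ∈ U \ interF L, ∑ l ∈ U \ interF L, if adj k l then β / 6 else 0 := by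
  have hI : interF L ⊆ U := (interF_subset_lamF L).trans hU
  have hval : ∀ k : interF L, val L θ k = θ k := fun k => dif_pos k.2
  have inner : energyP L β θ =
      β / 6 * ∑ k ∈ interF L, ∑ l ∈ interF L,
        (if adj k l then Real.cos (val L θ k - val L θ l) else 0) +
      β / 3 * ∑ k ∈ interF L, (nBd L k : ℝ) * Real.cos (val L θ k) := by
    rw [energyP, energy0, ← Finset.sum_coe_sort (interF L), ← Finset.sum_coe_sort (interF L)]
    simp_rw [← Finset.sum_coe_sort (interF L)
      (fun l => if adj _ l then Real.cos (val L θ _ - val L θ l) else 0), hval]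
  have cross : ∀ k ∈ interF L, ∑ l ∈ U \ interF L,
      (if adj k l then β / 6 else 0) * Real.cos (val L θ k - val L θ l) =
        β / 6 * (nBd L k * Real.cos (val L θ k)) := by
    intro k hk
    rw [← sum_boundary_eq hU hk, Finset.mul_sum]
    refine Finset.sum_congr rfl fun l hl => ?_
    rw [val_of_notMem θ (Finset.mem_sdiff.1 hl).2, sub_zero]
    split_ifs <;> simp
  have cross' : ∑ k ∈ U \ interF L, ∑ l ∈ interF L,
      (if adj k l then β / 6 else 0) * Real.cos (val L θ k - val L θ l) =
        ∑ k ∈ interF L, β / 6 * (nBd L k * Real.cos (val L θ k)) := by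
    rw [Finset.sum_comm, ← Finset.sum_congr rfl cross]
    refine Finset.sum_congr rfl fun l _ => Finset.sum_congr rfl fun k _ => ?_
    rw [← Real.cos_neg, neg_sub]
    simp only [adj_comm]
  have outer : ∑ k ∈ U \ interF L, ∑ l ∈ U \ interF L,
      (if adj k l then β / 6 else 0) * Real.cos (val L θ k - val L θ l) =
        ∑ k ∈ U \ interF L, ∑ l ∈ U \ interF L, if adj k l then β / 6 else 0 := by
    refine Finset.sum_congr rfl fun k hk => Finset.sum_congr rfl fun l hl => ?_
    rw [val_of_notMem θ (Finset.mem_sdiff.1 hl).2, val_of_notMem θ (Finset.mem_sdiff.1 hk).2]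
    simp
  have split : ∀ f : Site → ℝ, ∑ k ∈ U, f k = ∑ k ∈ U \ interF L, f k + ∑ k ∈ interF L, f k :=
    fun f => (Finset.sum_sdiff hI).symm
  simp_rw [split, Finset.sum_add_distrib]
  rw [outer, cross', Finset.sum_congr rfl cross, inner, ← Finset.mul_sum]
  have : ∑ k ∈ interF L, ∑ l ∈ interF L,
      (if adj k l then β / 6 else 0) * Real.cos (val L θ k - val L θ l) =
      β / 6 * ∑ k ∈ interF L, ∑ l ∈ interF L,
        (if adj k l then Real.cos (val L θ k - val L θ l) else 0) := by
    simp_rw [Finset.mul_sum]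
    refine Finset.sum_congr rfl fun k _ => Finset.sum_congr rfl fun l _ => ?_
    split_ifs <;> simp
  rw [this]
  ring

/-- Extension by `0` to `W` of a configuration on the translated interior `v + Λ_L°`. -/
noncomputable def extendAngles {L : ℕ} (W : Finset Site) (v : Site) (φ : interF L → AngleCircle) :
    W → AngleCircle :=
  fun k => if h : k.1 - v ∈ interF L then φ ⟨k.1 - v, h⟩ else 0

theorem continuous_extendAngles {L : ℕ} (W : Finset Site) (v : Site) :
    Continuous (extendAngles (L := L) W v) := by
  refine continuous_pi fun k => ?_
  unfold extendAngles
  split_ifs <;> fun_prop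

theorem extendAngles_coe {L : ℕ} (W : Finset Site) (v : Site) (θ : Cfg L) (k : W) :
    extendAngles W v (fun i => (θ i : AngleCircle)) k = (val L θ (k.1 - v) : AngleCircle) := by
  unfold extendAngles val
  split_ifs <;> simp

theorem xyEnergy_extendAngles {L : ℕ} (β : ℝ) (W : Finset Site) (v : Site)
    (hW : ∀ k ∈ lamF L, k + v ∈ W) :
    ∃ C : ℝ, ∀ θ : Cfg L, xyEnergy W β (extendAngles W v fun i => (θ i : AngleCircle)) =
      energyP L β θ + C := by
  have hU : lamF L ⊆ W.map (Equiv.subRight v).toEmbedding := fun k hk =>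
    Finset.mem_map.2 ⟨k + v, hW k hk, by simp⟩
  refine ⟨_, fun θ => Eq.trans ?_ (energy_val_eq β hU θ)⟩
  rw [Finset.sum_map, xyEnergy, Fintype.sum_prod_type, ← Finset.sum_coe_sort W]
  refine Finset.sum_congr rfl fun k _ => ?_
  rw [Finset.sum_map, ← Finset.sum_coe_sort W]
  refine Finset.sum_congr rfl fun l _ => ?_
  simp only [extendAngles_coe, ← AddCircle.coe_sub, AngleCircle.cos_coe,
    Equiv.coe_toEmbedding, Equiv.subRight_apply, adj_sub_right]

theorem magAt_eq_cutMag {L : ℕ} (β : ℝ) {W : Finset Site} {v : Site}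
    (hW : ∀ k ∈ lamF L, k + v ∈ W) {x : Site} (hx : x + v ∈ W) :
    magAt L β x = cutMag W β {k | k.1 - v ∈ interF L} ⟨x + v, hx⟩ := by
  let e : interF L → W := fun k => ⟨k.1 + v, hW k.1 (interF_subset_lamF L k.2)⟩
  have he : Function.Injective e := fun a b h =>
    Subtype.ext (add_right_cancel (congrArg Subtype.val h))
  let R : (W → AngleCircle) →+ (interF L → AngleCircle) :=
    { toFun := fun θ => θ ∘ e, map_zero' := rfl, map_add' := fun _ _ => rfl }
  have hRc : Continuous R := Pi.continuous_precomp e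
  have hR : MeasurePreserving R (angleMeasure W) (angleMeasure (interF L)) :=
    AddMonoidHom.measurePreserving hRc he.surjective_comp_right (by simp)
  have hind : ∀ θ : W → AngleCircle,
      Set.indicator {k : W | k.1 - v ∈ interF L} θ = extendAngles W v (R θ) := by
    intro θ
    ext k
    by_cases hk : k.1 - v ∈ interF L
    · rw [Set.indicator_of_mem (s := {k : W | k.1 - v ∈ interF L}) hk, extendAngles, dif_pos hk]
      change θ k = θ _
      congr 1
      ext1
      simp [e]
    · rw [Set.indicator_of_notMem (s := {k : W | k.1 - v ∈ interF L}) hk, extendAngles, dif_neg hk]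
  obtain ⟨C, hC⟩ := xyEnergy_extendAngles β W v hW
  obtain ⟨c, hc, hcube⟩ := integral_cube_coe L
  have hext := continuous_extendAngles (L := L) W v
  have transfer : ∀ F : (interF L → AngleCircle) → ℝ, Continuous F →
      ∫ θ, F (R θ) ∂(angleMeasure W) =
        c⁻¹ * ∫ θ in cube L, F (fun k => (θ k : AngleCircle)) := by
    intro F hF
    rw [hcube F hF, inv_mul_cancel_left₀ hc, ← hR.map_eq,
      integral_map hR.aemeasurable hF.aestronglyMeasurable]
  rw [cutMag]
  simp_rw [hind]
  rw [transfer (fun φ => AngleCircle.cos (extendAngles W v φ ⟨x + v, hx⟩) *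
      exp (xyEnergy W β (extendAngles W v φ))) (by fun_prop),
    transfer (fun φ => exp (xyEnergy W β (extendAngles W v φ))) (by fun_prop)]
  simp only [hC, extendAngles_coe, AngleCircle.cos_coe, add_sub_cancel_right, exp_add,
    ← mul_assoc, integral_mul_const]
  rw [mul_div_mul_right _ _ (exp_ne_zero C), mul_div_mul_left _ _ (inv_ne_zero hc)]
  rfl

theorem magAt_le_magAt {β : ℝ} (hβ : 0 < β) {L M : ℕ} {u v x : Site}
    (h : ∀ k, k - v ∈ interF L → k - u ∈ interF M) :
    magAt M β (x - u) ≤ magAt L β (x - v) := by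
  let W : Finset Site := insert x ((lamF L).image (· + v) ∪ (lamF M).image (· + u))
  have hL : ∀ k ∈ lamF L, k + v ∈ W := fun k hk => Finset.mem_insert_of_mem
    (Finset.mem_union_left _ (Finset.mem_image_of_mem _ hk))
  have hM : ∀ k ∈ lamF M, k + u ∈ W := fun k hk => Finset.mem_insert_of_mem
    (Finset.mem_union_right _ (Finset.mem_image_of_mem _ hk))
  have hx : ∀ w, x - w + w ∈ W := fun w => by
    rw [sub_add_cancel]; exact Finset.mem_insert_self _ _
  rw [magAt_eq_cutMag β hL (hx v), magAt_eq_cutMag β hM (hx u)]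
  simp only [sub_add_cancel]
  exact cutMag_anti hβ (fun k hk => h k hk) _

theorem neg_one_le_magAt (L : ℕ) (β : ℝ) (x : Site) : -1 ≤ magAt L β x := by
  rw [magAt_eq_cutMag β (W := insert x (lamF L)) (v := 0)
    (fun k hk => by simpa using Or.inr hk) (by simp)]
  exact neg_one_le_cutMag _ _

theorem abs_le_supNorm (y : Site) (i : Fin 3) : |y i| ≤ supNorm y := by
  fin_cases i <;> simp [supNorm]

/-- Translation invariance of the infinite-volume plus-boundary magnetization. -/
theorem magnetization_translation_invariant
    (β : ℝ) (hβ : 0 < β) (y : Site) :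
    sInf {r : ℝ | ∃ L : ℕ, supNorm y < (L : ℤ) ∧ r = magAt L β y}
        = sInf {r : ℝ | ∃ L : ℕ, 2 ≤ L ∧ r = magAt L β 0} ∧
    sInf {r : ℝ | ∃ L : ℕ, 2 ≤ L ∧ r = magAt L β 0} = mStar β := by
  refine ⟨?_, rfl⟩
  set N := (supNorm y).toNat
  have hy : ∀ i, |y i| ≤ (N : ℤ) := fun i =>
    (abs_le_supNorm y i).trans (Int.self_le_toNat _)
  have bdd : ∀ (p : ℕ → Prop) (x : Site), BddBelow {r : ℝ | ∃ L : ℕ, p L ∧ r = magAt L β x} := by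
    rintro p x
    refine ⟨-1, ?_⟩
    rintro _ ⟨L, -, rfl⟩
    exact neg_one_le_magAt L β x
  have shift : ∀ (L : ℕ) (u v k : Site), (∀ i, |v i - u i| ≤ N) → k - v ∈ interF L →
      k - u ∈ interF (L + N + 2) := by
    intro L u v k huv hk
    simp only [interF, Finset.mem_Icc, Pi.le_def, Pi.sub_apply] at hk ⊢
    push_cast
    refine ⟨fun i => ?_, fun i => ?_⟩ <;>
    · have := abs_le.1 (huv i)
      have := hk.1 i
      have := hk.2 i
      omega
  refine le_antisymm (le_csInf ⟨_, 2, le_rfl, rfl⟩ ?_)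
    (le_csInf ⟨_, N + 1, by omega, rfl⟩ ?_)
  · rintro _ ⟨L, -, rfl⟩
    refine (csInf_le (bdd _ _) ⟨L + N + 2, by omega, rfl⟩).trans ?_
    have h := magAt_le_magAt hβ (x := y) fun k => shift L 0 y k (by simpa using hy)
    simpa using h
  · rintro _ ⟨L, -, rfl⟩
    refine (csInf_le (bdd _ _) ⟨L + N + 2, by omega, rfl⟩).trans ?_
    have h := magAt_le_magAt hβ (x := y) fun k => shift L y 0 k (by simpa using hy)
    simpa using h
end

section
/- Random path representation of the XY partition function: (2π)^{-|Λ|} ∫_{[0,2π]^Λ} exp(β Σ_{(k,l)∈E} J(k,l) cos(θ_k − θ_l)) dθ = Σ_n ∏_{(k,l)∈E} (β J(k,l))^{n(k,l)} / n(k,l)!, where the sum on the right (an absolutely convergent sum over a countable index set) ranges over all n : E → ℕ satisfying the conservation law out_n(z) = in_n(z) for every z ∈ Λ. -/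
open MeasureTheory Real

noncomputable section

/-- Directed edge-multiplicity functions `n : E → ℕ` (zero on the diagonal) satisfying the
conservation law `out_n(z) = in_n(z)` at every site. -/
def consSet (Λ : Type) [Fintype Λ] : Set (Λ → Λ → ℕ) :=
  {n | (∀ k, n k k = 0) ∧ ∀ z : Λ, (∑ l, n z l) = ∑ l, n l z}

/-- The weight `∏_{(k,l)∈E} (βJ(k,l))^{n(k,l)} / n(k,l)!` of a directed multigraph
(the diagonal contributes the factor `1` since `n k k = 0`). -/
def pathWeight {Λ : Type} [Fintype Λ] (β : ℝ) (J : Λ → Λ → ℝ) (n : Λ → Λ → ℕ) : ℝ :=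
  ∏ k, ∏ l, (β * J k l) ^ (n k l) / (n k l).factorial

/-- A product of counting measures is the counting measure. -/
lemma pi_count_eq_count {ι α : Type*} [Fintype ι] [Countable α] [MeasurableSpace α]
    [MeasurableSingletonClass α] :
    Measure.pi (fun _ : ι => (Measure.count : Measure α)) = Measure.count := by
  refine Measure.ext_of_singleton fun x => ?_
  rw [Measure.pi_singleton]
  simp

/-- Absolutely convergent series may be multiplied over a finite index type, with an absolutely
convergent expansion. -/
lemma summable_norm_and_hasSum_pi {ι α : Type*} [Fintype ι] [Countable α] {f : ι → α → ℂ}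
    {s : ι → ℂ} (hf : ∀ i, Summable fun a => ‖f i a‖) (hs : ∀ i, HasSum (f i) (s i)) :
    (Summable fun x : ι → α => ‖∏ i, f i (x i)‖) ∧
      HasSum (fun x : ι → α => ∏ i, f i (x i)) (∏ i, s i) := by
  let mα : MeasurableSpace α := ⊤
  have hint : ∀ i, Integrable (f i) Measure.count := fun i => integrable_count_iff.2 (hf i)
  have hprod : Integrable (fun x : ι → α => ∏ i, f i (x i)) Measure.count := by
    rw [← pi_count_eq_count]
    exact Integrable.fintype_prod hint
  have hsum := integrable_count_iff.1 hprod
  refine ⟨hsum, ?_⟩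
  have htsum : ∑' x : ι → α, ∏ i, f i (x i) = ∏ i, s i := by
    have h := integral_fintype_prod_eq_prod (𝕜 := ℂ) f
      (μ := fun _ : ι => (Measure.count : Measure α))
    rw [pi_count_eq_count, integral_countable hprod] at h
    simp_rw [fun i => integral_countable (hint i)] at h
    simpa [Measure.real, (hs _).tsum_eq] using h
  exact htsum ▸ hsum.of_norm.hasSum

/-- Orthogonality of characters on `[0, 2π]`. -/
lemma integral_Icc_exp_int_mul (m : ℤ) :
    ∫ t in Set.Icc (0 : ℝ) (2 * π), Complex.exp (Complex.I * m * t) =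
      if m = 0 then ((2 * π : ℝ) : ℂ) else 0 := by
  rw [integral_Icc_eq_integral_Ioc, ← intervalIntegral.integral_of_le (by positivity)]
  split_ifs with h
  · simp [h]
  · have hc : Complex.I * (m : ℂ) ≠ 0 := mul_ne_zero Complex.I_ne_zero (by exact_mod_cast h)
    rw [integral_exp_mul_complex hc]
    have : Complex.I * (m : ℂ) * ((2 * π : ℝ) : ℂ) = m * (2 * π * Complex.I) := by
      push_cast; ring
    rw [this, Complex.exp_int_mul_two_pi_mul_I]
    simp

/-- The summand of the expansion of the Gibbs weight, including its angular dependence. -/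
def pathTerm {Λ : Type} [Fintype Λ] (β : ℝ) (J : Λ → Λ → ℝ) (n : Λ → Λ → ℕ) (θ : Λ → ℝ) : ℂ :=
  ∏ k, ∏ l, ((β * J k l : ℝ) * Complex.exp (Complex.I * (θ k - θ l))) ^ (n k l) /
    (n k l).factorial

lemma pathTerm_eq {Λ : Type} [Fintype Λ] (β : ℝ) (J : Λ → Λ → ℝ) (n : Λ → Λ → ℕ) (θ : Λ → ℝ) :
    pathTerm β J n θ = pathWeight β J n *
      ∏ k, Complex.exp (Complex.I * ((∑ l, (n k l : ℤ) - ∑ l, (n l k : ℤ) : ℤ) : ℂ) * θ k) := by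
  have hexp : ∏ k, ∏ l, Complex.exp (Complex.I * (θ k - θ l)) ^ (n k l) =
      ∏ k, Complex.exp (Complex.I * ((∑ l, (n k l : ℤ) - ∑ l, (n l k : ℤ) : ℤ) : ℂ) * θ k) := by
    simp_rw [← Complex.exp_nat_mul, ← Complex.exp_sum]
    congr 1
    have h : ∀ k l, (n k l : ℂ) * (Complex.I * (θ k - θ l)) =
        Complex.I * n k l * θ k - Complex.I * n k l * θ l := fun k l => by ring
    simp_rw [h, Finset.sum_sub_distrib]
    rw [Finset.sum_comm (f := fun k l => Complex.I * (n k l : ℂ) * (θ l : ℂ))]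
    push_cast
    simp_rw [mul_sub, sub_mul, Finset.sum_sub_distrib, Finset.mul_sum, Finset.sum_mul]
  rw [← hexp, pathTerm, pathWeight]
  push_cast
  simp_rw [← Finset.prod_mul_distrib]
  refine Finset.prod_congr rfl fun k _ => Finset.prod_congr rfl fun l _ => ?_
  rw [mul_pow]; ring

lemma norm_pathTerm {Λ : Type} [Fintype Λ] (β : ℝ) (J : Λ → Λ → ℝ) (n : Λ → Λ → ℕ)
    (θ : Λ → ℝ) : ‖pathTerm β J n θ‖ = |pathWeight β J n| := by
  have h : ∀ (m : ℤ) (t : ℝ), ‖Complex.exp (Complex.I * m * t)‖ = 1 := fun m t => by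
    simp [Complex.norm_exp]
  rw [pathTerm_eq, norm_mul, norm_prod]
  simp_rw [h]
  simp

lemma summable_norm_and_hasSum_pathTerm {Λ : Type} [Fintype Λ] (β : ℝ) (J : Λ → Λ → ℝ)
    (θ : Λ → ℝ) :
    (Summable fun n => ‖pathTerm β J n θ‖) ∧ HasSum (fun n => pathTerm β J n θ)
      (Complex.exp (∑ k, ∑ l, (β * J k l : ℝ) * Complex.exp (Complex.I * (θ k - θ l)))) := by
  simp_rw [Complex.exp_sum]
  have h := fun k => summable_norm_and_hasSum_pi
    (f := fun l (m : ℕ) =>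
      (((β * J k l : ℝ) : ℂ) * Complex.exp (Complex.I * (θ k - θ l))) ^ m / m.factorial)
    (fun l => NormedSpace.norm_expSeries_div_summable (𝔸 := ℂ) _)
    (fun l => by
      have := NormedSpace.expSeries_div_hasSum_exp (𝔸 := ℂ)
        (((β * J k l : ℝ) : ℂ) * Complex.exp (Complex.I * (θ k - θ l)))
      rwa [← Complex.exp_eq_exp_ℂ] at this)
  exact summable_norm_and_hasSum_pi
    (f := fun k (m : Λ → ℕ) => ∏ l,
      (((β * J k l : ℝ) : ℂ) * Complex.exp (Complex.I * (θ k - θ l))) ^ m l / (m l).factorial)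
    (fun k => (h k).1) (fun k => (h k).2)

/-- For a symmetric coupling the imaginary parts cancel between opposite directed edges. -/
lemma sum_mul_exp_eq_sum_mul_cos {Λ : Type} [Fintype Λ] (β : ℝ) (J : Λ → Λ → ℝ)
    (hsym : ∀ k l, J k l = J l k) (θ : Λ → ℝ) :
    ∑ k, ∑ l, ((β * J k l : ℝ) : ℂ) * Complex.exp (Complex.I * (θ k - θ l)) =
      ((β * ∑ k, ∑ l, J k l * Real.cos (θ k - θ l) : ℝ) : ℂ) := by
  have hsin : ∑ k, ∑ l, J k l * Real.sin (θ k - θ l) = 0 := by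
    have h : ∑ k, ∑ l, J k l * Real.sin (θ k - θ l) =
        -∑ k, ∑ l, J k l * Real.sin (θ k - θ l) := by
      conv_lhs => rw [Finset.sum_comm]
      simp_rw [← Finset.sum_neg_distrib]
      refine Finset.sum_congr rfl fun k _ => Finset.sum_congr rfl fun l _ => ?_
      rw [hsym l k, ← neg_sub (θ k), Real.sin_neg, mul_neg]
    linarith
  have hterm : ∀ k l, ((β * J k l : ℝ) : ℂ) * Complex.exp (Complex.I * (θ k - θ l)) =
      β * ((J k l * Real.cos (θ k - θ l) : ℝ) : ℂ) +
        β * Complex.I * ((J k l * Real.sin (θ k - θ l) : ℝ) : ℂ) := fun k l => by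
    rw [mul_comm Complex.I, Complex.exp_mul_I]
    push_cast
    ring
  simp_rw [hterm, Finset.sum_add_distrib, ← Finset.mul_sum, ← Complex.ofReal_sum]
  rw [hsin]
  simp

lemma volume_restrict_pi_Icc {Λ : Type} [Fintype Λ] :
    (volume : Measure (Λ → ℝ)).restrict (Set.univ.pi fun _ : Λ => Set.Icc (0 : ℝ) (2 * π)) =
      Measure.pi fun _ : Λ => volume.restrict (Set.Icc (0 : ℝ) (2 * π)) := by
  rw [volume_pi, Measure.restrict_pi_pi]

lemma integral_pathTerm {Λ : Type} [Fintype Λ] (β : ℝ) (J : Λ → Λ → ℝ)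
    (hdiag : ∀ k, J k k = 0) (n : Λ → Λ → ℕ) :
    ∫ θ in (Set.univ.pi fun _ : Λ => Set.Icc (0 : ℝ) (2 * π)), pathTerm β J n θ =
      (((2 * π) ^ Fintype.card Λ * (consSet Λ).indicator (pathWeight β J) n : ℝ) : ℂ) := by
  classical
  simp_rw [pathTerm_eq]
  rw [integral_const_mul, volume_restrict_pi_Icc, integral_fintype_prod_eq_prod (𝕜 := ℂ)
    (fun k t => Complex.exp
      (Complex.I * ((∑ l, (n k l : ℤ) - ∑ l, (n l k : ℤ) : ℤ) : ℂ) * (t : ℝ)))]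
  simp_rw [integral_Icc_exp_int_mul]
  by_cases hn : n ∈ consSet Λ
  · have h : ∀ k, ∑ l, (n k l : ℤ) - ∑ l, (n l k : ℤ) = 0 := fun k => by
      rw [sub_eq_zero]; exact_mod_cast hn.2 k
    simp [h, hn, mul_comm]
  · rw [Set.indicator_of_notMem hn, mul_zero, Complex.ofReal_zero, mul_eq_zero]
    by_cases hd : ∀ k, n k k = 0
    · right
      obtain ⟨z, hz⟩ : ∃ z, ∑ l, n z l ≠ ∑ l, n l z := by
        by_contra! h
        exact hn ⟨hd, h⟩
      refine Finset.prod_eq_zero (Finset.mem_univ z) (if_neg ?_)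
      rw [sub_eq_zero]; exact_mod_cast hz
    · left
      push Not at hd
      obtain ⟨k, hk⟩ := hd
      rw [Complex.ofReal_eq_zero]
      exact Finset.prod_eq_zero (Finset.mem_univ k)
        (Finset.prod_eq_zero (Finset.mem_univ k) (by simp [hdiag, hk]))

/-- Random path representation of the XY partition function. -/
theorem random_path_representation_partition_function
    (Λ : Type) [Fintype Λ] [Nonempty Λ]
    (J : Λ → Λ → ℝ) (hsym : ∀ k l, J k l = J l k) (hnn : ∀ k l, 0 ≤ J k l)
    (hdiag : ∀ k, J k k = 0) (β : ℝ) (hβ : 0 ≤ β) :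
    Summable (fun n : ↥(consSet Λ) => pathWeight β J n.1) ∧
    ((2 * π) ^ (Fintype.card Λ))⁻¹ *
        (∫ θ in (Set.univ.pi fun _ : Λ => Set.Icc (0 : ℝ) (2 * π)),
          Real.exp (β * ∑ k, ∑ l, J k l * Real.cos (θ k - θ l))) =
      ∑' n : ↥(consSet Λ), pathWeight β J n.1 := by
  have hpos : (0 : ℝ) < (2 * π) ^ Fintype.card Λ := by positivity
  have hcont : ∀ n, Continuous (pathTerm β J n) := fun n => by
    unfold pathTerm
    fun_prop
  have hw : Summable fun n => |pathWeight β J n| := by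
    simpa only [norm_pathTerm] using (summable_norm_and_hasSum_pathTerm β J 0).1
  have hcompact : IsCompact (Set.univ.pi fun _ : Λ => Set.Icc (0 : ℝ) (2 * π)) :=
    isCompact_univ_pi fun _ => isCompact_Icc
  have hsum := hasSum_integral_of_summable_integral_norm
    (μ := volume.restrict (Set.univ.pi fun _ : Λ => Set.Icc (0 : ℝ) (2 * π)))
    (F := pathTerm β J) (fun n => (hcont n).continuousOn.integrableOn_compact hcompact)
    (by
      simp_rw [norm_pathTerm, integral_const, smul_eq_mul]
      exact hw.mul_left _)
  simp_rw [fun θ => (summable_norm_and_hasSum_pathTerm β J θ).2.tsum_eq,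
    sum_mul_exp_eq_sum_mul_cos β J hsym, integral_pathTerm β J hdiag, ← Complex.ofReal_exp] at hsum
  rw [integral_complex_ofReal, Complex.hasSum_ofReal] at hsum
  have hsum' := hsum.mul_left ((2 * π) ^ Fintype.card Λ)⁻¹
  simp_rw [inv_mul_cancel_left₀ hpos.ne'] at hsum'
  have hcons := hasSum_subtype_iff_indicator.2 hsum'
  exact ⟨hcons.summable, hcons.tsum_eq.symm⟩

end
end

section
/- Random path representation of the XY two-point function: for distinct x, y ∈ Λ, (2π)^{-|Λ|} ∫_{[0,2π]^Λ} cos(θ_x − θ_y) exp(β Σ_{(k,l)∈E} J(k,l) cos(θ_k − θ_l)) dθ = (1/2) [ Σ_{n ∈ 𝒩(x,y)} ∏_{(k,l)∈E} (β J(k,l))^{n(k,l)}/n(k,l)! + Σ_{n ∈ 𝒩(y,x)} ∏_{(k,l)∈E} (β J(k,l))^{n(k,l)}/n(k,l)! ], both sums being absolutely convergent. -/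
open MeasureTheory Real

noncomputable section

/-- Directed edge-multiplicity functions `n : E → ℕ` (zero on the diagonal) with
`out_n(z) − in_n(z) = 1` at `z = y`, `−1` at `z = x`, and `0` elsewhere. -/
def sourceSinkSet (Λ : Type) [Fintype Λ] [DecidableEq Λ] (x y : Λ) : Set (Λ → Λ → ℕ) :=
  {n | (∀ k, n k k = 0) ∧ ∀ z : Λ,
    ((∑ l, n z l : ℕ) : ℤ) - ((∑ l, n l z : ℕ) : ℤ)
      = if z = y then 1 else if z = x then -1 else 0}

/-- Expansion of a finite product of absolutely convergent series, indexed by `Fin N`. -/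
theorem hasSum_prod_fin {R κ : Type*} [NormedCommRing R] [CompleteSpace R] {N : ℕ}
    {f : Fin N → κ → R} {s : Fin N → R} (hf : ∀ i, HasSum (f i) (s i))
    (hn : ∀ i, Summable fun k => ‖f i k‖) :
    (Summable fun n : Fin N → κ => ‖∏ i, f i (n i)‖) ∧
      HasSum (fun n : Fin N → κ => ∏ i, f i (n i)) (∏ i, s i) := by
  induction N with
  | zero =>
    refine ⟨(hasSum_fintype _).summable, ?_⟩
    simp
  | succ N ih =>
    obtain ⟨h1, h2⟩ := ih (fun i => hf i.succ) (fun i => hn i.succ)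
    have hnorm := (hn 0).mul_norm h1
    have hsum := (hf 0).mul h2 hnorm.of_norm
    let e : κ × (Fin N → κ) ≃ (Fin (N + 1) → κ) := Fin.consEquiv fun _ => κ
    have he (p : κ × (Fin N → κ)) :
        ∏ i, f i (e p i) = f 0 p.1 * ∏ i : Fin N, f i.succ (p.2 i) := by
      simp [e, Fin.consEquiv, Fin.prod_univ_succ]
    rw [Fin.prod_univ_succ]
    exact ⟨e.summable_iff.1 (hnorm.congr fun p => by simp only [Function.comp_apply, he]),
      e.hasSum_iff.1 (hsum.congr_fun fun p => by simp only [Function.comp_apply, he])⟩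

/-- Expansion of a finite product of absolutely convergent series. -/
theorem hasSum_prod_fintype {R ι κ : Type*} [NormedCommRing R] [CompleteSpace R] [Fintype ι]
    {f : ι → κ → R} {s : ι → R} (hf : ∀ i, HasSum (f i) (s i))
    (hn : ∀ i, Summable fun k => ‖f i k‖) :
    (Summable fun n : ι → κ => ‖∏ i, f i (n i)‖) ∧
      HasSum (fun n : ι → κ => ∏ i, f i (n i)) (∏ i, s i) := by
  let e := Fintype.equivFin ι
  obtain ⟨h1, h2⟩ := hasSum_prod_fin (fun i => hf (e.symm i)) (fun i => hn (e.symm i))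
  have key (n : ι → κ) :
      ∏ i, f (e.symm i) ((e.arrowCongr (Equiv.refl κ)) n i) = ∏ i, f i (n i) := by
    simpa using e.symm.prod_comp fun i => f i (n i)
  rw [← (e.arrowCongr (Equiv.refl κ)).summable_iff] at h1
  rw [← (e.arrowCongr (Equiv.refl κ)).hasSum_iff, e.symm.prod_comp s] at h2
  exact ⟨h1.congr fun n => by simp only [Function.comp_apply, key],
    h2.congr_fun fun n => by simp only [Function.comp_apply, key]⟩

/-- Multivariate exponential series, indexed by matrices of exponents. -/
theorem hasSum_prod_prod_pow_div_factorial {ι : Type*} [Fintype ι] (a : ι → ι → ℂ) :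
    (Summable fun n : ι → ι → ℕ => ‖∏ k, ∏ l, a k l ^ n k l / (n k l).factorial‖) ∧
      HasSum (fun n : ι → ι → ℕ => ∏ k, ∏ l, a k l ^ n k l / (n k l).factorial)
        (Complex.exp (∑ k, ∑ l, a k l)) := by
  have hs (z : ℂ) : HasSum (fun n : ℕ => z ^ n / n.factorial) (Complex.exp z) := by
    rw [Complex.exp_eq_exp_ℂ]
    exact NormedSpace.expSeries_div_hasSum_exp z
  have hrow (k : ι) := hasSum_prod_fintype (fun l => hs (a k l))
    (fun l => NormedSpace.norm_expSeries_div_summable (a k l))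
  simpa only [Complex.exp_sum] using
    hasSum_prod_fintype (fun k => (hrow k).2) (fun k => (hrow k).1)

/-- Orthogonality of characters on `[0, 2π]`. -/
theorem integral_exp_int_mul_I (m : ℤ) :
    ∫ t in Set.Icc (0 : ℝ) (2 * π), Complex.exp (Complex.I * (m * t)) =
      if m = 0 then ((2 * π : ℝ) : ℂ) else 0 := by
  rw [integral_Icc_eq_integral_Ioc, ← intervalIntegral.integral_of_le (by positivity)]
  split_ifs with h
  · simp [h]
  · have hc : Complex.I * m ≠ 0 := mul_ne_zero Complex.I_ne_zero (by exact_mod_cast h)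
    simp_rw [← mul_assoc]
    rw [integral_exp_mul_complex hc]
    have : Complex.I * m * ((2 * π : ℝ) : ℂ) = m * (2 * π * Complex.I) := by
      push_cast; ring
    rw [this, Complex.exp_int_mul_two_pi_mul_I]
    simp

/-- Orthogonality of characters on the box `[0, 2π]^Λ`. -/
theorem integral_pi_exp_int_mul_I {Λ : Type*} [Fintype Λ] (c : Λ → ℤ) :
    ∫ θ in (Set.univ.pi fun _ : Λ => Set.Icc (0 : ℝ) (2 * π)),
        Complex.exp (Complex.I * ∑ z, (c z : ℂ) * (θ z : ℂ)) =
      if ∀ z, c z = 0 then (((2 * π) ^ Fintype.card Λ : ℝ) : ℂ) else 0 := by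
  simp_rw [Finset.mul_sum, Complex.exp_sum]
  rw [volume_pi, Measure.restrict_pi_pi,
    integral_fintype_prod_eq_prod (fun z (t : ℝ) => Complex.exp (Complex.I * (c z * t)))]
  simp_rw [integral_exp_int_mul_I]
  split_ifs with h
  · simp [h]
  · push Not at h
    obtain ⟨z, hz⟩ := h
    exact Finset.prod_eq_zero (Finset.mem_univ z) (by simp [hz])

theorem pathWeight_nonneg {Λ : Type} [Fintype Λ] {J : Λ → Λ → ℝ} (hnn : ∀ k l, 0 ≤ J k l)
    {β : ℝ} (hβ : 0 ≤ β) (n : Λ → Λ → ℕ) : 0 ≤ pathWeight β J n :=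
  Finset.prod_nonneg fun k _ => Finset.prod_nonneg fun l _ =>
    div_nonneg (pow_nonneg (mul_nonneg hβ (hnn k l)) _) (Nat.cast_nonneg _)

theorem summable_pathWeight {Λ : Type} [Fintype Λ] {J : Λ → Λ → ℝ} (hnn : ∀ k l, 0 ≤ J k l)
    {β : ℝ} (hβ : 0 ≤ β) : Summable (pathWeight β J) := by
  refine (hasSum_prod_prod_pow_div_factorial fun k l => ((β * J k l : ℝ) : ℂ)).1.congr fun n => ?_
  rw [← abs_of_nonneg (pathWeight_nonneg hnn hβ n), ← Real.norm_eq_abs, ← Complex.norm_real]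
  simp [pathWeight]

theorem pathWeight_eq_zero {Λ : Type} [Fintype Λ] {J : Λ → Λ → ℝ} (hdiag : ∀ k, J k k = 0)
    (β : ℝ) {n : Λ → Λ → ℕ} {k : Λ} (hk : n k k ≠ 0) : pathWeight β J n = 0 :=
  Finset.prod_eq_zero (Finset.mem_univ k)
    (Finset.prod_eq_zero (Finset.mem_univ k) (by simp [hdiag, hk]))

/-- The excess of `n` over the prescribed divergence of a source at `y` and a sink at `x`. -/
def excessDivergence {Λ : Type} [Fintype Λ] [DecidableEq Λ] (x y : Λ) (n : Λ → Λ → ℕ) (z : Λ) : ℤ :=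
  ((∑ l, n z l : ℕ) : ℤ) - ((∑ l, n l z : ℕ) : ℤ) - if z = y then 1 else if z = x then -1 else 0

theorem sum_excessDivergence_mul {Λ : Type} [Fintype Λ] [DecidableEq Λ] {x y : Λ} (hxy : x ≠ y)
    (n : Λ → Λ → ℕ) (t : Λ → ℂ) :
    ∑ z, (excessDivergence x y n z : ℂ) * t z =
      (t x - t y) + ∑ k, ∑ l, (n k l : ℂ) * (t k - t l) := by
  have hsrc (z : Λ) : ((if z = y then 1 else if z = x then -1 else 0 : ℤ) : ℂ) * t z =
      (if z = y then t z else 0) - if z = x then t z else 0 := by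
    by_cases h1 : z = y
    · have h2 : z ≠ x := fun h => hxy (h.symm.trans h1)
      simp [h1, h1 ▸ h2]
    · by_cases h2 : z = x <;> simp [h1, h2, hxy]
  simp_rw [excessDivergence, Int.cast_sub, sub_mul, hsrc, mul_sub, Finset.sum_sub_distrib]
  rw [Finset.sum_comm (f := fun k l => (n k l : ℂ) * t l)]
  simp [Finset.sum_mul]
  ring

/-- The Fourier mode contributed by `n` to the expansion of the two-point integrand. -/
def pathMode {Λ : Type} [Fintype Λ] [DecidableEq Λ] (β : ℝ) (J : Λ → Λ → ℝ) (x y : Λ)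
    (n : Λ → Λ → ℕ) (θ : Λ → ℝ) : ℂ :=
  pathWeight β J n * Complex.exp (Complex.I * ∑ z, (excessDivergence x y n z : ℂ) * (θ z : ℂ))

theorem norm_pathMode {Λ : Type} [Fintype Λ] [DecidableEq Λ] {J : Λ → Λ → ℝ}
    (hnn : ∀ k l, 0 ≤ J k l) {β : ℝ} (hβ : 0 ≤ β) (x y : Λ) (n : Λ → Λ → ℕ) (θ : Λ → ℝ) :
    ‖pathMode β J x y n θ‖ = pathWeight β J n := by
  have : Complex.I * ∑ z, (excessDivergence x y n z : ℂ) * (θ z : ℂ) =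
      ((∑ z, (excessDivergence x y n z : ℝ) * θ z : ℝ) : ℂ) * Complex.I := by
    push_cast; ring
  rw [pathMode, norm_mul, this, Complex.norm_exp_ofReal_mul_I, Complex.norm_real,
    Real.norm_eq_abs, abs_of_nonneg (pathWeight_nonneg hnn hβ n), mul_one]

theorem sum_mul_cexp_sub_eq_sum_mul_cos {Λ : Type*} [Fintype Λ] {J : Λ → Λ → ℝ}
    (hsym : ∀ k l, J k l = J l k) (θ : Λ → ℝ) :
    ∑ k, ∑ l, (J k l : ℂ) * Complex.exp (Complex.I * (θ k - θ l)) =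
      ((∑ k, ∑ l, J k l * Real.cos (θ k - θ l) : ℝ) : ℂ) := by
  have hswap : ∑ k, ∑ l, (J k l : ℂ) * Complex.exp (Complex.I * (θ k - θ l)) =
      ∑ k, ∑ l, (J k l : ℂ) * Complex.exp (-(θ k - θ l) * Complex.I) := by
    rw [Finset.sum_comm]
    refine Finset.sum_congr rfl fun k _ => Finset.sum_congr rfl fun l _ => ?_
    rw [hsym l k]
    congr 2
    ring
  have htwo : ∑ k, ∑ l, (J k l : ℂ) * Complex.exp (Complex.I * (θ k - θ l)) +
      ∑ k, ∑ l, (J k l : ℂ) * Complex.exp (-(θ k - θ l) * Complex.I) =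
      2 * ((∑ k, ∑ l, J k l * Real.cos (θ k - θ l) : ℝ) : ℂ) := by
    push_cast
    simp_rw [← Finset.sum_add_distrib, Finset.mul_sum]
    refine Finset.sum_congr rfl fun k _ => Finset.sum_congr rfl fun l _ => ?_
    rw [mul_left_comm, Complex.two_cos, mul_comm Complex.I, mul_add]
  rw [← hswap, ← two_mul] at htwo
  exact mul_left_cancel₀ two_ne_zero htwo

theorem hasSum_pathMode {Λ : Type} [Fintype Λ] [DecidableEq Λ] {J : Λ → Λ → ℝ}
    (hsym : ∀ k l, J k l = J l k) (β : ℝ) {x y : Λ} (hxy : x ≠ y) (θ : Λ → ℝ) :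
    HasSum (fun n => pathMode β J x y n θ)
      (Complex.exp (Complex.I * (θ x - θ y)) *
        ((Real.exp (β * ∑ k, ∑ l, J k l * Real.cos (θ k - θ l)) : ℝ) : ℂ)) := by
  have h := (hasSum_prod_prod_pow_div_factorial fun k l =>
    (β : ℂ) * ((J k l : ℂ) * Complex.exp (Complex.I * (θ k - θ l)))).2.mul_left
      (Complex.exp (Complex.I * (θ x - θ y)))
  simp_rw [← Finset.mul_sum] at h
  rw [sum_mul_cexp_sub_eq_sum_mul_cos hsym, ← Complex.ofReal_mul, ← Complex.ofReal_exp] at h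
  refine h.congr_fun fun n => ?_
  rw [pathMode, sum_excessDivergence_mul hxy, mul_add, Complex.exp_add, mul_left_comm]
  congr 1
  simp_rw [pathWeight, Finset.mul_sum, Complex.exp_sum]
  push_cast
  simp_rw [← Finset.prod_mul_distrib]
  refine Finset.prod_congr rfl fun k _ => Finset.prod_congr rfl fun l _ => ?_
  rw [mul_left_comm Complex.I, Complex.exp_nat_mul]
  ring

theorem mem_sourceSinkSet_iff {Λ : Type} [Fintype Λ] [DecidableEq Λ] {x y : Λ} {n : Λ → Λ → ℕ} :
    n ∈ sourceSinkSet Λ x y ↔ (∀ k, n k k = 0) ∧ ∀ z, excessDivergence x y n z = 0 := by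
  simp only [sourceSinkSet, excessDivergence, Set.mem_ofPred_eq, sub_eq_zero]

theorem integral_pathMode {Λ : Type} [Fintype Λ] [DecidableEq Λ] {J : Λ → Λ → ℝ}
    (hdiag : ∀ k, J k k = 0) (β : ℝ) (x y : Λ) (n : Λ → Λ → ℕ) :
    ∫ θ in (Set.univ.pi fun _ : Λ => Set.Icc (0 : ℝ) (2 * π)), pathMode β J x y n θ =
      (((2 * π) ^ Fintype.card Λ *
        (sourceSinkSet Λ x y).indicator (pathWeight β J) n : ℝ) : ℂ) := by
  simp_rw [pathMode]
  rw [integral_const_mul, integral_pi_exp_int_mul_I]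
  by_cases hn : ∀ k, n k k = 0
  · by_cases hc : ∀ z, excessDivergence x y n z = 0
    · rw [if_pos hc, Set.indicator_of_mem (mem_sourceSinkSet_iff.2 ⟨hn, hc⟩)]
      push_cast; ring
    · rw [if_neg hc, Set.indicator_of_notMem fun h => hc (mem_sourceSinkSet_iff.1 h).2]
      simp
  · rw [Set.indicator_of_notMem fun h => hn (mem_sourceSinkSet_iff.1 h).1]
    push Not at hn
    obtain ⟨k, hk⟩ := hn
    simp [pathWeight_eq_zero hdiag β hk]

/-- The two-point function is a single sum over directed multigraphs with source `y` and
sink `x`. -/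
theorem integral_cos_mul_exp_eq_tsum_pathWeight {Λ : Type} [Fintype Λ] [DecidableEq Λ]
    {J : Λ → Λ → ℝ} (hsym : ∀ k l, J k l = J l k) (hnn : ∀ k l, 0 ≤ J k l)
    (hdiag : ∀ k, J k k = 0) {β : ℝ} (hβ : 0 ≤ β) {x y : Λ} (hxy : x ≠ y) :
    ∫ θ in (Set.univ.pi fun _ : Λ => Set.Icc (0 : ℝ) (2 * π)),
        Real.cos (θ x - θ y) * Real.exp (β * ∑ k, ∑ l, J k l * Real.cos (θ k - θ l)) =
      (2 * π) ^ Fintype.card Λ * ∑' n : ↥(sourceSinkSet Λ x y), pathWeight β J n.1 := by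
  set B : Set (Λ → ℝ) := Set.univ.pi fun _ : Λ => Set.Icc (0 : ℝ) (2 * π) with hB
  have hcompact : IsCompact B := isCompact_univ_pi fun _ => isCompact_Icc
  have hint (n : Λ → Λ → ℕ) : Integrable (pathMode β J x y n) (volume.restrict B) := by
    refine ContinuousOn.integrableOn_compact hcompact (Continuous.continuousOn ?_)
    unfold pathMode
    fun_prop
  have hsummable : Summable fun n => ∫ θ in B, ‖pathMode β J x y n θ‖ := by
    simp_rw [norm_pathMode hnn hβ, integral_const, smul_eq_mul]
    exact (summable_pathWeight hnn hβ).mul_left _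
  have h := hasSum_integral_of_summable_integral_norm hint hsummable
  simp_rw [(hasSum_pathMode hsym β hxy _).tsum_eq, hB, integral_pathMode hdiag] at h
  have hre := (Complex.hasSum_re h).tsum_eq
  simp only [Complex.ofReal_re] at hre
  rw [tsum_mul_left, ← tsum_subtype, ← RCLike.re_eq_complex_re, ← integral_re] at hre
  · rw [hre]
    refine integral_congr_ae (Filter.Eventually.of_forall fun θ => ?_)
    simp only [RCLike.re_eq_complex_re]
    rw [Complex.re_mul_ofReal, mul_comm Complex.I, ← Complex.ofReal_sub,
      Complex.exp_ofReal_mul_I_re]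
  · exact ContinuousOn.integrableOn_compact hcompact (Continuous.continuousOn (by fun_prop))

/-- Random path representation of the XY two-point function. -/
theorem random_path_representation_two_point
    (Λ : Type) [Fintype Λ] [Nonempty Λ] [DecidableEq Λ]
    (J : Λ → Λ → ℝ) (hsym : ∀ k l, J k l = J l k) (hnn : ∀ k l, 0 ≤ J k l)
    (hdiag : ∀ k, J k k = 0) (β : ℝ) (hβ : 0 ≤ β)
    (x y : Λ) (hxy : x ≠ y) :
    Summable (fun n : ↥(sourceSinkSet Λ x y) => pathWeight β J n.1) ∧
    Summable (fun n : ↥(sourceSinkSet Λ y x) => pathWeight β J n.1) ∧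
    ((2 * π) ^ (Fintype.card Λ))⁻¹ *
        (∫ θ in (Set.univ.pi fun _ : Λ => Set.Icc (0 : ℝ) (2 * π)),
          Real.cos (θ x - θ y) *
            Real.exp (β * ∑ k, ∑ l, J k l * Real.cos (θ k - θ l))) =
      (1 / 2) * ((∑' n : ↥(sourceSinkSet Λ x y), pathWeight β J n.1) +
        ∑' n : ↥(sourceSinkSet Λ y x), pathWeight β J n.1) := by
  have hw := summable_pathWeight hnn hβ
  have hcos : ∀ θ : Λ → ℝ, Real.cos (θ x - θ y) = Real.cos (θ y - θ x) := fun θ => by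
    rw [← Real.cos_neg, neg_sub]
  have hxy_eq := integral_cos_mul_exp_eq_tsum_pathWeight hsym hnn hdiag hβ hxy
  have hyx_eq := integral_cos_mul_exp_eq_tsum_pathWeight hsym hnn hdiag hβ hxy.symm
  simp_rw [← hcos] at hyx_eq
  have hpos : ((2 * π) ^ Fintype.card Λ) ≠ 0 := by positivity
  have heq := mul_left_cancel₀ hpos (hxy_eq.symm.trans hyx_eq)
  refine ⟨hw.subtype _, hw.subtype _, ?_⟩
  rw [hxy_eq, inv_mul_cancel_left₀ hpos, ← heq]
  ring

end
end
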